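/- arXiv:1212.3233 — 8 statements merged into one kernel-verified Lean document; each statement's English description precedes it below -/
import Mathlib

section
/- For every JRP-D instance (C, c, D) with times in {1,…,U} and every feasible fractional solution x of the LP relaxation, there exists a feasible schedule S with cost(S) ≤ 1.574 · cost(x). In particular, the integrality gap of the LP relaxation of JRP-D is at most 1.574. -/
namespace JRPD

/-- Density on `[θ, 1]` of the gap between consecutive warehouse orders; the remaining probability
mass is placed at `1`. -/
noncomputable def gapDensity (θ s : ℝ) : ℝ := min 1 (4 * θ / s - 1) / s

lemma continuousOn_gapDensity {θ : ℝ} {S : Set ℝ} (hS : ∀ s ∈ S, 0 < s) :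
    ContinuousOn (gapDensity θ) S := by
  have h : ∀ s ∈ S, s ≠ 0 := fun s hs => (hS s hs).ne'
  unfold gapDensity
  fun_prop (disch := assumption)

lemma gapDensity_of_le {θ s : ℝ} (hs : 0 < s) (h : s ≤ 2 * θ) : gapDensity θ s = 1 / s := by
  unfold gapDensity
  rw [min_eq_left]
  rw [le_sub_iff_add_le, le_div_iff₀ hs]
  linarith

lemma gapDensity_of_ge {θ s : ℝ} (hs : 0 < s) (h : 2 * θ ≤ s) :
    gapDensity θ s = (4 * θ / s - 1) / s := by
  unfold gapDensity
  rw [min_eq_right]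
  rw [sub_le_iff_le_add, div_le_iff₀ hs]
  linarith

lemma gapDensity_nonneg {θ s : ℝ} (hs : 0 < s) (h : s ≤ 4 * θ) : 0 ≤ gapDensity θ s := by
  unfold gapDensity
  refine div_nonneg (le_min zero_le_one ?_) hs.le
  rw [sub_nonneg, le_div_iff₀ hs]
  linarith

lemma intervalIntegrable_mul_gapDensity {θ a b : ℝ} {f : ℝ → ℝ} (ha : 0 < a) (hb : 0 < b)
    (hf : Continuous f) :
    IntervalIntegrable (fun s => f s * gapDensity θ s) MeasureTheory.volume a b :=
  (hf.continuousOn.mul (continuousOn_gapDensity fun _ hs =>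
    (lt_min ha hb).trans_le hs.1)).intervalIntegrable

lemma intervalIntegrable_gapDensity {θ a b : ℝ} (ha : 0 < a) (hb : 0 < b) :
    IntervalIntegrable (gapDensity θ) MeasureTheory.volume a b := by
  simpa using intervalIntegrable_mul_gapDensity (θ := θ) ha hb (continuous_const (y := (1 : ℝ)))

lemma integral_gapDensity {θ : ℝ} (hθ : 0 < θ) (hθ' : θ ≤ 1 / 2) :
    ∫ s in θ..1, gapDensity θ s = Real.log 2 + 2 - 4 * θ + Real.log (2 * θ) := by
  have h₁ : ∫ s in θ..2 * θ, gapDensity θ s = Real.log 2 := by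
    rw [intervalIntegral.integral_congr (g := fun s => 1 / s),
      integral_one_div_of_pos hθ (by linarith)]
    · congr 1; field_simp
    · intro s hs
      rw [Set.uIcc_of_le (by linarith)] at hs
      exact gapDensity_of_le (by linarith [hs.1]) hs.2
  have h₂ : ∫ s in 2 * θ..1, gapDensity θ s = 2 - 4 * θ + Real.log (2 * θ) := by
    rw [intervalIntegral.integral_eq_sub_of_hasDerivAt (f := fun s => -(4 * θ) / s - Real.log s) _
      (intervalIntegrable_gapDensity (by linarith) one_pos)]
    · simp only [Real.log_one]; field_simp; ring
    · intro s hs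
      rw [Set.uIcc_of_le (by linarith)] at hs
      have hs0 : 0 < s := by linarith [hs.1]
      rw [gapDensity_of_ge hs0 hs.1]
      refine (((hasDerivAt_const s (-(4 * θ))).div (hasDerivAt_id' s) hs0.ne').sub
        (Real.hasDerivAt_log hs0.ne')).congr_deriv ?_
      field_simp; ring
  rw [← intervalIntegral.integral_add_adjacent_intervals
    (intervalIntegrable_gapDensity hθ (by linarith : 0 < 2 * θ))
    (intervalIntegrable_gapDensity (by linarith) one_pos), h₁, h₂]
  ring

lemma integral_one_sub_mul_gapDensity {θ : ℝ} (hθ : 0 < θ) (hθ' : θ ≤ 1 / 2) :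
    ∫ s in θ..1, (1 - s) * gapDensity θ s =
      Real.log 2 + 3 - 7 * θ + (1 + 4 * θ) * Real.log (2 * θ) := by
  have hi : ∀ a b : ℝ, 0 < a → 0 < b → IntervalIntegrable (fun s => (1 - s) * gapDensity θ s)
      MeasureTheory.volume a b := fun a b ha hb =>
    intervalIntegrable_mul_gapDensity ha hb (by fun_prop)
  have h₁ : ∫ s in θ..2 * θ, (1 - s) * gapDensity θ s = Real.log 2 - θ := by
    rw [intervalIntegral.integral_eq_sub_of_hasDerivAt (f := fun s => Real.log s - s) _
      (hi _ _ hθ (by linarith))]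
    · simp only [Real.log_mul two_ne_zero hθ.ne']; ring
    · intro s hs
      rw [Set.uIcc_of_le (by linarith)] at hs
      have hs0 : 0 < s := by linarith [hs.1]
      rw [gapDensity_of_le hs0 hs.2]
      refine ((Real.hasDerivAt_log hs0.ne').sub (hasDerivAt_id' s)).congr_deriv ?_
      field_simp
  have h₂ : ∫ s in 2 * θ..1, (1 - s) * gapDensity θ s =
      3 - 6 * θ + (1 + 4 * θ) * Real.log (2 * θ) := by
    rw [intervalIntegral.integral_eq_sub_of_hasDerivAt
      (f := fun s => -(4 * θ) / s - (1 + 4 * θ) * Real.log s + s) _ (hi _ _ (by linarith) one_pos)]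
    · simp only [Real.log_one]; field_simp; ring
    · intro s hs
      rw [Set.uIcc_of_le (by linarith)] at hs
      have hs0 : 0 < s := by linarith [hs.1]
      rw [gapDensity_of_ge hs0 hs.1]
      refine ((((hasDerivAt_const s (-(4 * θ))).div (hasDerivAt_id' s) hs0.ne').sub
        ((Real.hasDerivAt_log hs0.ne').const_mul (1 + 4 * θ))).add
        (hasDerivAt_id' s)).congr_deriv ?_
      field_simp; ring
  rw [← intervalIntegral.integral_add_adjacent_intervals (hi _ _ hθ (by linarith : 0 < 2 * θ))
    (hi _ _ (by linarith) one_pos), h₁, h₂]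
  ring

lemma three_mul_sub_one_le_mul_log_add_log {w : ℝ} (hw : 1 ≤ w) :
    3 * (w - 1) ≤ w * Real.log w + 4 * Real.log ((1 + w) / 2) := by
  have hd : ∀ v : ℝ, 0 < v → HasDerivAt
      (fun v => v * Real.log v + 4 * Real.log ((1 + v) / 2) - 3 * (v - 1))
      (Real.log v - 2 * (v - 1) / (v + 1)) v := by
    intro v hv
    refine ((((hasDerivAt_id' v).mul (Real.hasDerivAt_log hv.ne')).add
      (((((hasDerivAt_id' v).const_add 1).div_const 2).log (by positivity)).const_mul 4)).sub
      (((hasDerivAt_id' v).sub_const 1).const_mul 3)).congr_deriv ?_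
    field_simp
    ring
  have hm : MonotoneOn (fun v => v * Real.log v + 4 * Real.log ((1 + v) / 2) - 3 * (v - 1))
      (Set.Ici 1) := by
    refine monotoneOn_of_deriv_nonneg (convex_Ici 1)
      (fun v hv => (hd v (zero_lt_one.trans_le hv)).continuousAt.continuousWithinAt)
      (fun v hv => ?_) (fun v hv => ?_)
    all_goals
      rw [interior_Ici] at hv
      have hv0 : (0 : ℝ) < v := zero_lt_one.trans hv
    · exact (hd v hv0).differentiableAt.differentiableWithinAt
    · rw [(hd v hv0).deriv]
      have := Real.le_log_one_add_of_nonneg (x := v - 1) (sub_nonneg.2 (le_of_lt hv))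
      rw [show v - 1 + 2 = v + 1 by ring, show 1 + (v - 1) = v by ring] at this
      linarith
  have := hm (Set.mem_Ici.2 le_rfl) (Set.mem_Ici.2 hw) hw
  norm_num at this
  linarith

/-- Lower bound on the expected progress made before a target at distance `T`. -/
lemma sub_le_integral_max_mul_gapDensity {θ T : ℝ} (hθ : 1 / 3 ≤ θ) (hT : θ ≤ T) (hT1 : T ≤ 1) :
    T - θ ≤ ∫ s in θ..T, max s (T - θ) * gapDensity θ s := by
  have hθ0 : 0 < θ := by linarith
  have hi : ∀ a b : ℝ, 0 < a → 0 < b →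
      IntervalIntegrable (fun s => max s (T - θ) * gapDensity θ s) MeasureTheory.volume a b :=
    fun a b ha hb => intervalIntegrable_mul_gapDensity ha hb (by fun_prop)
  rcases le_total T (2 * θ) with h | h
  · have hone : ∫ s in θ..T, (1 : ℝ) = T - θ := by simp
    refine hone.symm.le.trans (intervalIntegral.integral_mono_on hT (by simp)
      (hi θ T hθ0 (by linarith)) ?_)
    intro s hs
    have hs0 : 0 < s := by linarith [hs.1]
    rw [gapDensity_of_le hs0 (hs.2.trans h), mul_one_div, le_div_iff₀ hs0, one_mul]
    exact le_max_left _ _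
  · set z := T - θ with hz
    have hzθ : θ ≤ z := by linarith
    have hz2 : z ≤ 2 * θ := by linarith
    have hz0 : 0 < z := by linarith
    have h₁ : ∫ s in θ..z, max s z * gapDensity θ s = z * Real.log (z / θ) := by
      rw [← integral_one_div_of_pos hθ0 hz0, ← intervalIntegral.integral_const_mul]
      refine intervalIntegral.integral_congr fun s hs => ?_
      rw [Set.uIcc_of_le hzθ] at hs
      rw [gapDensity_of_le (by linarith [hs.1]) (by linarith [hs.2]), max_eq_right hs.2]
    have h₂ : ∫ s in z..2 * θ, max s z * gapDensity θ s = 2 * θ - z := by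
      rw [intervalIntegral.integral_congr (g := fun _ => (1 : ℝ))]
      · simp
      · intro s hs
        rw [Set.uIcc_of_le hz2] at hs
        have hs0 : 0 < s := by linarith [hs.1]
        beta_reduce
        rw [gapDensity_of_le hs0 hs.2, max_eq_left hs.1, mul_one_div_cancel hs0.ne']
    have h₃ : ∫ s in 2 * θ..T, max s z * gapDensity θ s =
        4 * θ * Real.log (T / (2 * θ)) - (T - 2 * θ) := by
      rw [intervalIntegral.integral_eq_sub_of_hasDerivAt (f := fun s => 4 * θ * Real.log s - s) _
        (hi _ _ (by linarith) (by linarith))]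
      · rw [Real.log_div (by linarith) (by linarith)]; ring
      · intro s hs
        rw [Set.uIcc_of_le h] at hs
        have hs0 : 0 < s := by linarith [hs.1]
        rw [gapDensity_of_ge hs0 hs.1, max_eq_left (hz2.trans hs.1)]
        refine (((Real.hasDerivAt_log hs0.ne').const_mul (4 * θ)).sub
          (hasDerivAt_id' s)).congr_deriv ?_
        field_simp
    rw [← intervalIntegral.integral_add_adjacent_intervals (hi θ (2 * θ) hθ0 (by linarith))
        (hi _ _ (by linarith) (by linarith)),
      ← intervalIntegral.integral_add_adjacent_intervals (hi θ z hθ0 hz0)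
        (hi _ _ hz0 (by linarith)), h₁, h₂, h₃]
    have key := three_mul_sub_one_le_mul_log_add_log ((one_le_div hθ0).2 hzθ)
    rw [show (1 + z / θ) / 2 = T / (2 * θ) by rw [hz]; field_simp; ring] at key
    have := mul_le_mul_of_nonneg_left key hθ0.le
    have e₁ : θ * (3 * (z / θ - 1)) = 3 * z - 3 * θ := by field_simp
    have e₂ : θ * (z / θ * Real.log (z / θ) + 4 * Real.log (T / (2 * θ))) =
        z * Real.log (z / θ) + 4 * θ * Real.log (T / (2 * θ)) := by field_simp
    rw [e₁, e₂] at this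
    linarith

/-- Expectation of `f` under the gap distribution. -/
noncomputable def gapMean (θ : ℝ) (f : ℝ → ℝ) : ℝ :=
  (∫ s in θ..1, f s * gapDensity θ s) + (1 - ∫ s in θ..1, gapDensity θ s) * f 1

/-- Bound on the distance between the last warehouse order before a target and that target, where
the target is at distance `T` and the next warehouse order is at distance `s`. -/
noncomputable def waste (θ T s : ℝ) : ℝ := if s ≤ T then min (T - s) θ else T

lemma waste_eq (θ T s : ℝ) :
    waste θ T s = T - (Set.Iic T).indicator (fun s => max s (T - θ)) s := by
  unfold waste
  by_cases h : s ≤ T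
  · rw [if_pos h, Set.indicator_of_mem (Set.mem_Iic.2 h)]
    rcases le_total s (T - θ) with h' | h'
    · rw [max_eq_right h', min_eq_right (by linarith)]; ring
    · rw [max_eq_left h', min_eq_left (by linarith)]
  · rw [if_neg h, Set.indicator_of_notMem (by simpa using h), sub_zero]

lemma intervalIntegrable_indicator_mul_gapDensity {θ T : ℝ} (hθ : 0 < θ) :
    IntervalIntegrable
      (fun s => (Set.Iic T).indicator (fun s => max s (T - θ)) s * gapDensity θ s)
      MeasureTheory.volume θ 1 := by
  have h := intervalIntegrable_mul_gapDensity (θ := θ) (f := fun s => max s (T - θ)) hθ one_pos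
    (by fun_prop)
  have e : (fun s => (Set.Iic T).indicator (fun s => max s (T - θ)) s * gapDensity θ s) =
      (Set.Iic T).indicator (fun s => max s (T - θ) * gapDensity θ s) := by
    ext s
    rw [Set.indicator_mul_left]
  rw [e]
  exact ⟨h.1.indicator measurableSet_Iic, h.2.indicator measurableSet_Iic⟩

lemma intervalIntegrable_waste_mul_gapDensity {θ T a : ℝ} (hθ : 0 < θ) :
    IntervalIntegrable (fun s => (waste θ T s - a) * gapDensity θ s)
      MeasureTheory.volume θ 1 := by
  have h := (intervalIntegrable_mul_gapDensity (θ := θ) (f := fun _ => T - a) hθ one_pos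
    (by fun_prop)).sub (intervalIntegrable_indicator_mul_gapDensity (T := T) hθ)
  refine h.congr fun s _ => ?_
  simp only [waste_eq]
  ring

lemma gapMean_nonpos {θ : ℝ} {f : ℝ → ℝ} (hθ : 1 / 3 ≤ θ) (hθ' : θ ≤ 1 / 2)
    (hmass : Real.log 2 + 2 - 4 * θ + Real.log (2 * θ) < 1)
    (hf : ∀ s ∈ Set.Icc θ 1, f s ≤ 0) : gapMean θ f ≤ 0 := by
  unfold gapMean
  rw [integral_gapDensity (by linarith) hθ']
  have h₁ : ∫ s in θ..1, f s * gapDensity θ s ≤ 0 := by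
    rw [← neg_nonneg, ← intervalIntegral.integral_neg]
    refine intervalIntegral.integral_nonneg (by linarith) fun s hs => ?_
    rw [← neg_mul]
    exact mul_nonneg (neg_nonneg.2 (hf s hs))
      (gapDensity_nonneg (by linarith [hs.1]) (by linarith [hs.2]))
  have h₂ := hf 1 ⟨by linarith, le_rfl⟩
  nlinarith

lemma gapMean_waste_sub_nonpos {θ T : ℝ} (hθ : 1 / 3 ≤ θ) (hθ' : θ ≤ 1 / 2)
    (hmass : Real.log 2 + 2 - 4 * θ + Real.log (2 * θ) < 1) :
    gapMean θ (fun s => waste θ T s - min T θ) ≤ 0 := by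
  rcases lt_or_ge T θ with h | h
  · refine gapMean_nonpos hθ hθ' hmass fun s hs => ?_
    rw [waste, if_neg (by linarith [hs.1]), min_eq_left h.le, sub_self]
  rw [min_eq_right h]
  rcases lt_or_ge T 1 with h1 | h1
  · have hθ0 : 0 < θ := by linarith
    have hi := intervalIntegrable_indicator_mul_gapDensity (T := T) hθ0
    have hp := intervalIntegrable_mul_gapDensity (θ := θ) (f := fun _ => T - θ) hθ0 one_pos
      (by fun_prop)
    have e : ∀ s, (waste θ T s - θ) * gapDensity θ s = (T - θ) * gapDensity θ s -
        (Set.Iic T).indicator (fun s => max s (T - θ)) s * gapDensity θ s := fun s => by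
      rw [waste_eq]; ring
    have hT : ∫ s in θ..1, (Set.Iic T).indicator (fun s => max s (T - θ)) s * gapDensity θ s =
        ∫ s in θ..T, max s (T - θ) * gapDensity θ s := by
      rw [← intervalIntegral.integral_indicator (a₂ := T) (a₃ := 1) ⟨h, h1.le⟩]
      refine intervalIntegral.integral_congr fun s _ => ?_
      exact (Set.indicator_mul_left (Set.Iic T) (fun s => max s (T - θ)) (gapDensity θ)).symm
    have hmain := sub_le_integral_max_mul_gapDensity hθ h h1.le
    have h₁ : waste θ T 1 = T := if_neg (by linarith)
    unfold gapMean
    simp only [e]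
    rw [intervalIntegral.integral_sub hp hi, hT, intervalIntegral.integral_const_mul, h₁]
    linarith
  · refine gapMean_nonpos hθ hθ' hmass fun s hs => ?_
    rw [waste, if_pos (by linarith [hs.2])]
    exact sub_nonpos.2 (min_le_right _ _)

lemma gapMean_one_sub_div_nonpos {θ : ℝ} (hθ : 1 / 3 ≤ θ) (hθ' : θ ≤ 1 / 2)
    (hmean : Real.log 2 + 3 - 7 * θ + (1 + 4 * θ) * Real.log (2 * θ) ≤ θ) :
    gapMean θ (fun s => 1 - s / (1 - θ)) ≤ 0 := by
  have hθ0 : 0 < θ := by linarith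
  have hθ1 : 0 < 1 - θ := by linarith
  have e : ∀ s, (1 - s / (1 - θ)) * gapDensity θ s =
      1 / (1 - θ) * ((1 - s) * gapDensity θ s) - θ / (1 - θ) * gapDensity θ s := fun s => by
    field_simp; ring
  have hi := intervalIntegrable_mul_gapDensity (θ := θ) (f := fun s => 1 - s) hθ0 one_pos
    (by fun_prop)
  unfold gapMean
  simp only [e]
  rw [intervalIntegral.integral_sub (hi.const_mul _)
      ((intervalIntegrable_gapDensity hθ0 one_pos).const_mul _),
    intervalIntegral.integral_const_mul, intervalIntegral.integral_const_mul,
    integral_one_sub_mul_gapDensity hθ0 hθ']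
  have : 1 / (1 - θ) * (Real.log 2 + 3 - 7 * θ + (1 + 4 * θ) * Real.log (2 * θ)) ≤
      1 / (1 - θ) * θ := mul_le_mul_of_nonneg_left hmean (by positivity)
  have e₂ : 1 - 1 / (1 - θ) = -(1 / (1 - θ) * θ) := by field_simp; ring
  have e₃ : θ / (1 - θ) = 1 / (1 - θ) * θ := by ring
  rw [e₂, e₃]
  linarith

/-- Some gap length is at least as good as the average for a nonnegative combination of the
warehouse cost and the waste of finitely many targets. -/
lemma exists_gap {θ : ℝ} (hθ : 1 / 3 ≤ θ) (hθ' : θ ≤ 1 / 2)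
    (hmass : Real.log 2 + 2 - 4 * θ + Real.log (2 * θ) < 1)
    (hmean : Real.log 2 + 3 - 7 * θ + (1 + 4 * θ) * Real.log (2 * θ) ≤ θ)
    {ι : Type*} (Q : Finset ι) {C : ℝ} (hC : 0 ≤ C) {c : ι → ℝ} (hc : ∀ i, 0 ≤ c i) (T : ι → ℝ) :
    ∃ s ∈ Set.Icc θ 1, C * (1 - s / (1 - θ)) +
      ∑ i ∈ Q, c i * (waste θ (T i) s - min (T i) θ) ≤ 0 := by
  by_contra! hK
  have hθ0 : 0 < θ := by linarith
  have hi₁ : IntervalIntegrable (fun s => C * ((1 - s / (1 - θ)) * gapDensity θ s))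
      MeasureTheory.volume θ 1 :=
    (intervalIntegrable_mul_gapDensity hθ0 one_pos (by fun_prop)).const_mul C
  have hi₂ : ∀ i ∈ Q, IntervalIntegrable
      (fun s => c i * ((waste θ (T i) s - min (T i) θ) * gapDensity θ s))
      MeasureTheory.volume θ 1 := fun i _ =>
    (intervalIntegrable_waste_mul_gapDensity hθ0).const_mul _
  have hsum : gapMean θ (fun s => C * (1 - s / (1 - θ)) +
      ∑ i ∈ Q, c i * (waste θ (T i) s - min (T i) θ)) =
      C * gapMean θ (fun s => 1 - s / (1 - θ)) +
      ∑ i ∈ Q, c i * gapMean θ (fun s => waste θ (T i) s - min (T i) θ) := by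
    have e : ∀ s, (C * (1 - s / (1 - θ)) + ∑ i ∈ Q, c i * (waste θ (T i) s - min (T i) θ)) *
        gapDensity θ s = C * ((1 - s / (1 - θ)) * gapDensity θ s) +
        ∑ i ∈ Q, c i * ((waste θ (T i) s - min (T i) θ) * gapDensity θ s) := fun s => by
      rw [add_mul, Finset.sum_mul]
      simp only [mul_assoc]
    unfold gapMean
    simp only [e, mul_add, Finset.sum_add_distrib]
    rw [intervalIntegral.integral_add hi₁
        (by simpa only [Finset.sum_fn] using IntervalIntegrable.sum Q hi₂),
      intervalIntegral.integral_finsetSum hi₂, intervalIntegral.integral_const_mul,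
      Finset.mul_sum]
    simp only [intervalIntegral.integral_const_mul]
    have : ∀ i, (1 - ∫ s in θ..1, gapDensity θ s) * (c i * (waste θ (T i) 1 - min (T i) θ)) =
      c i * ((1 - ∫ s in θ..1, gapDensity θ s) * (waste θ (T i) 1 - min (T i) θ)) :=
      fun i => by ring
    simp only [this]
    ring
  have hle : C * gapMean θ (fun s => 1 - s / (1 - θ)) +
      ∑ i ∈ Q, c i * gapMean θ (fun s => waste θ (T i) s - min (T i) θ) ≤ 0 :=
    add_nonpos (mul_nonpos_of_nonneg_of_nonpos hC (gapMean_one_sub_div_nonpos hθ hθ' hmean))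
      (Finset.sum_nonpos fun i _ => mul_nonpos_of_nonneg_of_nonpos (hc i)
        (gapMean_waste_sub_nonpos hθ hθ' hmass))
  have hpos : 0 < gapMean θ (fun s => C * (1 - s / (1 - θ)) +
      ∑ i ∈ Q, c i * (waste θ (T i) s - min (T i) θ)) := by
    refine add_pos_of_nonneg_of_pos (intervalIntegral.integral_nonneg (by linarith) fun s hs =>
      mul_nonneg (hK s hs).le (gapDensity_nonneg (by linarith [hs.1]) (by linarith [hs.2])))
      (mul_pos ?_ (hK 1 ⟨by linarith, le_rfl⟩))
    rw [integral_gapDensity hθ0 hθ']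
    linarith
  linarith

lemma log_574_div_787_le : Real.log (574 / 787) ≤ -0.31555 := by
  have h := Real.hasSum_log_sub_log_of_abs_lt_one (x := 213 / 1361) (by norm_num [abs_lt])
  have h' := sum_le_hasSum (Finset.range 2) (fun k _ => by positivity) h
  rw [← Real.log_div (by norm_num) (by norm_num)] at h'
  norm_num [Finset.sum_range_succ] at h'
  rw [show (574 / 787 : ℝ) = (787 / 574)⁻¹ by norm_num, Real.log_inv]
  norm_num
  linarith

/-- The first position at which `F` has grown by `1` since `v`. -/
lemma exists_first_unit_growth {F : ℝ → ℝ} (hmono : Monotone F) (hcont : Continuous F)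
    {v : ℝ} (hv : ∃ w, F v + 1 ≤ F w) :
    ∃ d, F v + 1 ≤ F d ∧ ∀ w, F v + 1 ≤ F w → d ≤ w := by
  have hbdd : BddBelow {w | F v + 1 ≤ F w} :=
    ⟨v, fun w (hw : F v + 1 ≤ F w) => le_of_lt (hmono.reflect_lt (by linarith))⟩
  have hclosed : IsClosed {w | F v + 1 ≤ F w} := isClosed_le continuous_const hcont
  exact ⟨sInf {w | F v + 1 ≤ F w}, hclosed.csInf_mem hv hbdd, fun w hw => csInf_le hbdd hw⟩

/-- Bound on the expected number of future orders of a retailer whose next order is due at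
position `d`, when the current warehouse order is at position `u`. -/
noncomputable def potential (θ V : ℝ) (F : ℝ → ℝ) (d u : ℝ) : ℝ :=
  if d ≤ V then 1 + (F V - F d + min (d - u) θ) / (1 - θ) else 0

lemma potential_le {θ V u d u' : ℝ} {F : ℝ → ℝ} (hmono : Monotone F) (hθ1 : θ < 1)
    (hu : u ≤ V) (hd : F u + 1 ≤ F d) :
    potential θ V F d u' ≤ (F V - F u) / (1 - θ) := by
  have h1 : 0 < 1 - θ := by linarith
  unfold potential
  split_ifs with h
  · rw [← sub_nonneg]
    have : (F V - F u) / (1 - θ) - (1 + (F V - F d + min (d - u') θ) / (1 - θ)) =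
        ((F d - F u - 1) + (θ - min (d - u') θ)) / (1 - θ) := by field_simp; ring
    rw [this]
    exact div_nonneg (by linarith [min_le_right (d - u') θ]) h1.le
  · exact div_nonneg (sub_nonneg.2 (hmono hu)) h1.le

lemma one_le_potential {θ V u d : ℝ} {F : ℝ → ℝ} (hmono : Monotone F) (hθ0 : 0 ≤ θ)
    (hθ1 : θ < 1) (hud : u ≤ d) (hd : d ≤ V) : 1 ≤ potential θ V F d u := by
  rw [potential, if_pos hd, le_add_iff_nonneg_right]
  exact div_nonneg (add_nonneg (sub_nonneg.2 (hmono hd)) (le_min (sub_nonneg.2 hud) hθ0))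
    (by linarith)

lemma potential_nonneg {θ V u d : ℝ} {F : ℝ → ℝ} (hmono : Monotone F) (hθ0 : 0 ≤ θ)
    (hθ1 : θ < 1) (hud : u ≤ d) : 0 ≤ potential θ V F d u := by
  by_cases hd : d ≤ V
  · exact zero_le_one.trans (one_le_potential hmono hθ0 hθ1 hud hd)
  · rw [potential, if_neg hd]

/-- Orders placed at positions after `u`, together with the set `J` of retailers joining the
warehouse order at `u`, when each retailer `ρ` has its next order due at `d ρ`. -/
lemma exists_orders_after {θ : ℝ} (hθ : 1 / 3 ≤ θ) (hθ' : θ ≤ 1 / 2)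
    (hmass : Real.log 2 + 2 - 4 * θ + Real.log (2 * θ) < 1)
    (hmean : Real.log 2 + 3 - 7 * θ + (1 + 4 * θ) * Real.log (2 * θ) ≤ θ)
    {ι : Type*} [Fintype ι] [DecidableEq ι] {C V : ℝ} (hC : 0 ≤ C) {c : ι → ℝ}
    (hc : ∀ ρ, 0 ≤ c ρ) {F : ι → ℝ → ℝ} (hmono : ∀ ρ, Monotone (F ρ))
    (hlip : ∀ ρ a b, a ≤ b → F ρ b - F ρ a ≤ b - a)
    {next : ι → ℝ → ℝ} (hnext : ∀ ρ v, F ρ v + 1 ≤ F ρ (next ρ v))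
    (hnext_le : ∀ ρ v w, F ρ v + 1 ≤ F ρ w → next ρ v ≤ w)
    (n : ℕ) (u : ℝ) (d : ι → ℝ) (hud : ∀ ρ, u ≤ d ρ) (hu : u ≤ V) (hn : V - u < n * θ) :
    ∃ (S : Finset (ℝ × Finset ι)) (J : Finset ι), (∀ o ∈ S, u < o.1 ∧ o.1 ≤ V) ∧
      (∑ o ∈ S, (C + ∑ ρ ∈ o.2, c ρ)) + ∑ ρ ∈ J, c ρ ≤
        C * ((V - u) / (1 - θ)) + ∑ ρ, c ρ * potential θ V (F ρ) (d ρ) u ∧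
      ∀ ρ a b, d ρ ≤ b → b ≤ V → F ρ a + 1 ≤ F ρ b →
        (a < u ∧ ρ ∈ J) ∨ ∃ o ∈ S, ρ ∈ o.2 ∧ a < o.1 ∧ o.1 ≤ b := by
  have hθ0 : 0 < θ := by linarith
  have hθ1 : 0 < 1 - θ := by linarith
  induction n generalizing u d with
  | zero => simp only [Nat.cast_zero, zero_mul] at hn; linarith
  | succ n ih =>
  rcases lt_or_ge (V - u) 1 with hV | hV
  · refine ⟨∅, Finset.univ.filter (fun ρ => d ρ ≤ V), by simp, ?_, ?_⟩
    · rw [Finset.sum_empty, zero_add, Finset.sum_filter]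
      refine le_add_of_nonneg_of_le (mul_nonneg hC (div_nonneg (by linarith) hθ1.le))
        (Finset.sum_le_sum fun ρ _ => ?_)
      split_ifs with h
      · exact le_mul_of_one_le_right (hc ρ)
          (one_le_potential (hmono ρ) hθ0.le (by linarith) (hud ρ) h)
      · exact mul_nonneg (hc ρ) (potential_nonneg (hmono ρ) hθ0.le (by linarith) (hud ρ))
    · intro ρ a b hdb hbV hab
      refine Or.inl ⟨?_, by simpa using hdb.trans hbV⟩
      by_contra! hau
      have h₁ : a < b := (hmono ρ).reflect_lt (by linarith)
      linarith [hlip ρ a b h₁.le]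
  · obtain ⟨s, ⟨hs, hs1⟩, hcost⟩ := exists_gap hθ hθ' hmass hmean
      (Finset.univ.filter fun ρ => d ρ ≤ V) hC
      (fun ρ => div_nonneg (hc ρ) hθ1.le) (fun ρ => d ρ - u)
    set J : Finset ι := Finset.univ.filter (fun ρ => d ρ ≤ V ∧ d ρ - u < s) with hJ
    set d' : ι → ℝ := fun ρ => if ρ ∈ J then next ρ u else d ρ with hd'
    have hnext_ge : ∀ ρ, u + 1 ≤ next ρ u := fun ρ => by
      have h₁ := hnext ρ u
      have h₂ : u < next ρ u := (hmono ρ).reflect_lt (by linarith)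
      linarith [hlip ρ u _ h₂.le]
    have hud' : ∀ ρ, u + s ≤ d' ρ := fun ρ => by
      simp only [hd']
      split_ifs with h
      · linarith [hnext_ge ρ]
      · simp only [hJ, Finset.mem_filter, Finset.mem_univ, true_and, not_and, not_lt] at h
        rcases le_or_gt (d ρ) V with h₁ | h₁
        · linarith [h h₁]
        · linarith
    obtain ⟨S, J', hS, hScost, hScov⟩ := ih (u + s) d' hud' (by linarith)
      (by push_cast at hn; linarith)
    refine ⟨insert (u + s, J') S, J, ?_, ?_, ?_⟩
    · intro o ho
      rcases Finset.mem_insert.1 ho with rfl | ho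
      · constructor <;> dsimp only <;> linarith
      · exact ⟨by linarith [(hS o ho).1], (hS o ho).2⟩
    · have hnot : (u + s, J') ∉ S := fun h => lt_irrefl _ (hS _ h).1
      rw [Finset.sum_insert hnot]
      have hpot : ∀ ρ, c ρ * potential θ V (F ρ) (d' ρ) (u + s) + (if ρ ∈ J then c ρ else 0) ≤
          c ρ * potential θ V (F ρ) (d ρ) u + (if d ρ ≤ V then
            c ρ * (waste θ (d ρ - u) s - min (d ρ - u) θ) else 0) / (1 - θ) := fun ρ => by
        by_cases hdV : d ρ ≤ V
        · by_cases hds : d ρ - u < s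
          · have hρ : ρ ∈ J := by simp [hJ, hdV, hds]
            have h₁ : potential θ V (F ρ) (next ρ u) (u + s) ≤ (F ρ V - F ρ u) / (1 - θ) :=
              potential_le (hmono ρ) (by linarith) hu (hnext ρ u)
            have h₂ : (F ρ V - F ρ u) / (1 - θ) ≤
                (F ρ V - F ρ (d ρ) + (d ρ - u)) / (1 - θ) :=
              div_le_div_of_nonneg_right (by linarith [hlip ρ u (d ρ) (hud ρ)]) hθ1.le
            have h₃ := mul_le_mul_of_nonneg_left (h₁.trans h₂) (hc ρ)
            simp only [hd', if_pos hρ, if_pos hdV, waste, if_neg (not_le.2 hds)]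
            rw [potential.eq_def θ V (F ρ) (d ρ) u, if_pos hdV]
            refine (add_le_add_left h₃ _).trans (le_of_eq ?_)
            ring
          · have hρ : ρ ∉ J := by simp [hJ, hds]
            simp only [hd', if_neg hρ, if_pos hdV, waste, if_pos (not_lt.1 hds), potential]
            refine le_of_eq ?_
            rw [show d ρ - (u + s) = d ρ - u - s by ring]
            ring
        · have hρ : ρ ∉ J := by simp [hJ, hdV]
          simp [hd', hρ, hdV, potential]
      have hsum := Finset.sum_le_sum fun ρ (_ : ρ ∈ Finset.univ) => hpot ρ
      rw [Finset.sum_add_distrib, Finset.sum_add_distrib, ← Finset.sum_div,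
        ← Finset.sum_filter, ← Finset.sum_filter, Finset.filter_mem_eq_inter,
        Finset.univ_inter] at hsum
      have hsplit : C * ((V - u) / (1 - θ)) = C * ((V - (u + s)) / (1 - θ)) + C -
          C * (1 - s / (1 - θ)) := by field_simp; ring
      have hscale : C * (1 - s / (1 - θ)) + (∑ ρ with d ρ ≤ V,
          c ρ * (waste θ (d ρ - u) s - min (d ρ - u) θ)) / (1 - θ) ≤ 0 := by
        rw [Finset.sum_div]
        simpa only [div_mul_eq_mul_div] using hcost
      dsimp only
      linarith
    · intro ρ a b hdb hbV hab
      have hcov : d' ρ ≤ b → ∃ o ∈ insert (u + s, J') S, ρ ∈ o.2 ∧ a < o.1 ∧ o.1 ≤ b := by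
        intro hb
        rcases hScov ρ a b hb hbV hab with ⟨h₁, h₂⟩ | ⟨o, ho, h⟩
        · exact ⟨_, Finset.mem_insert_self _ _, h₂, h₁, (hud' ρ).trans hb⟩
        · exact ⟨o, Finset.mem_insert_of_mem ho, h⟩
      by_cases hρ : ρ ∈ J
      · rcases lt_or_ge a u with h | h
        · exact Or.inl ⟨h, hρ⟩
        · refine Or.inr (hcov ?_)
          simp only [hd', if_pos hρ]
          exact hnext_le ρ u b (by linarith [hmono ρ h])
      · refine Or.inr (hcov ?_)
        simpa only [hd', if_neg hρ] using hdb

lemma exists_orders {θ : ℝ} (hθ : 1 / 3 ≤ θ) (hθ' : θ ≤ 1 / 2)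
    (hmass : Real.log 2 + 2 - 4 * θ + Real.log (2 * θ) < 1)
    (hmean : Real.log 2 + 3 - 7 * θ + (1 + 4 * θ) * Real.log (2 * θ) ≤ θ)
    {ι : Type*} [Fintype ι] [DecidableEq ι] {C V : ℝ} (hC : 0 ≤ C) (hV : 0 ≤ V) {c : ι → ℝ}
    (hc : ∀ ρ, 0 ≤ c ρ) {F : ι → ℝ → ℝ} (hmono : ∀ ρ, Monotone (F ρ))
    (hlip : ∀ ρ a b, a ≤ b → F ρ b - F ρ a ≤ b - a) (hunb : ∀ ρ v, ∃ w, F ρ v + 1 ≤ F ρ w) :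
    ∃ S : Finset (ℝ × Finset ι), (∀ o ∈ S, 0 < o.1 ∧ o.1 ≤ V) ∧
      (∑ o ∈ S, (C + ∑ ρ ∈ o.2, c ρ)) ≤ (C * V + ∑ ρ, c ρ * (F ρ V - F ρ 0)) / (1 - θ) ∧
      ∀ ρ a b, 0 ≤ a → b ≤ V → F ρ a + 1 ≤ F ρ b → ∃ o ∈ S, ρ ∈ o.2 ∧ a < o.1 ∧ o.1 ≤ b := by
  have hcont : ∀ ρ, Continuous (F ρ) := fun ρ => by
    refine (LipschitzWith.of_dist_le_mul (K := 1) fun a b => ?_).continuous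
    rw [NNReal.coe_one, one_mul, Real.dist_eq, Real.dist_eq]
    rcases le_total a b with h | h
    · rw [abs_sub_comm, abs_of_nonneg (sub_nonneg.2 (hmono ρ h)), abs_sub_comm,
        abs_of_nonneg (sub_nonneg.2 h)]
      exact hlip ρ a b h
    · rw [abs_of_nonneg (sub_nonneg.2 (hmono ρ h)), abs_of_nonneg (sub_nonneg.2 h)]
      exact hlip ρ b a h
  choose next hnext hnext_le using fun ρ v =>
    exists_first_unit_growth (hmono ρ) (hcont ρ) (hunb ρ v)
  obtain ⟨n, hn⟩ := exists_nat_gt ((V - 0) / θ)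
  obtain ⟨S, J, hS, hcost, hcov⟩ := exists_orders_after hθ hθ' hmass hmean hC hc hmono hlip hnext
    hnext_le n 0 (fun ρ => next ρ 0)
    (fun ρ => ((hmono ρ).reflect_lt (by linarith [hnext ρ 0])).le) hV
    ((div_lt_iff₀ (by linarith)).1 hn)
  refine ⟨S, hS, ?_, fun ρ a b ha hb hab => ?_⟩
  · have hJ : 0 ≤ ∑ ρ ∈ J, c ρ := Finset.sum_nonneg fun ρ _ => hc ρ
    have hpot : ∑ ρ, c ρ * potential θ V (F ρ) (next ρ 0) 0 ≤
        ∑ ρ, c ρ * ((F ρ V - F ρ 0) / (1 - θ)) := Finset.sum_le_sum fun ρ _ =>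
      mul_le_mul_of_nonneg_left
        (potential_le (hmono ρ) (by linarith) hV (hnext ρ 0)) (hc ρ)
    rw [add_div, Finset.sum_div, mul_div_assoc]
    simp only [mul_div_assoc]
    rw [sub_zero] at hcost
    linarith
  · rcases hcov ρ a b (hnext_le ρ 0 b (by linarith [hmono ρ ha])) hb hab with ⟨h, -⟩ | h
    · exact absurd h ha.not_gt
    · exact h

/-- Total warehouse order amount at times `1, …, t`. -/
noncomputable def cumul (x : ℕ → ℝ) (t : ℕ) : ℝ := ∑ i ∈ Finset.range t, x (i + 1)

lemma cumul_eq_sum_Icc (x : ℕ → ℝ) (t : ℕ) : cumul x t = ∑ i ∈ Finset.Icc 1 t, x i := by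
  rw [cumul, Finset.range_eq_Ico, Finset.sum_Ico_add' x 0 t 1]
  rfl

lemma cumul_add_sum_Icc (x : ℕ → ℝ) {r d : ℕ} (hr : 1 ≤ r) (hrd : r ≤ d) :
    cumul x (r - 1) + ∑ t ∈ Finset.Icc r d, x t = cumul x d := by
  obtain ⟨r, rfl⟩ := Nat.exists_eq_add_of_le' hr
  rw [cumul_eq_sum_Icc, cumul_eq_sum_Icc, Nat.add_sub_cancel]
  have h := Finset.sum_Ioc_consecutive x (Nat.zero_le r) (by omega : r ≤ d)
  simpa only [← Finset.Icc_add_one_left_eq_Ioc, zero_add] using h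

lemma monotone_cumul {x : ℕ → ℝ} (hx : ∀ t, 0 ≤ x t) : Monotone (cumul x) :=
  monotone_nat_of_le_succ fun t => by
    rw [cumul, cumul, Finset.sum_range_succ]
    linarith [hx (t + 1)]

/-- Amount ordered by a retailer with order amounts `y` by the time the warehouse has ordered the
amount `w`, extended with slope `1` after time `U`. -/
noncomputable def progress (x y : ℕ → ℝ) (U : ℕ) (w : ℝ) : ℝ :=
  ∑ t ∈ Finset.range U, y (t + 1) / x (t + 1) * (min w (cumul x (t + 1)) - min w (cumul x t)) +
    max (w - cumul x U) 0

lemma min_sub_min_mono {p q a b : ℝ} (hpq : p ≤ q) (hab : a ≤ b) :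
    min a q - min a p ≤ min b q - min b p := by
  rcases le_total a p with h₁ | h₁ <;> rcases le_total a q with h₂ | h₂ <;>
    rcases le_total b p with h₃ | h₃ <;> rcases le_total b q with h₄ | h₄ <;>
    simp only [min_eq_left, min_eq_right, *] <;> linarith

lemma monotone_progress {x y : ℕ → ℝ} (hy : ∀ t, 0 ≤ y t) (hyx : ∀ t, y t ≤ x t) (U : ℕ) :
    Monotone (progress x y U) := by
  have hx : ∀ t, 0 ≤ x t := fun t => (hy t).trans (hyx t)
  intro a b hab
  refine add_le_add (Finset.sum_le_sum fun t _ => mul_le_mul_of_nonneg_left ?_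
    (div_nonneg (hy _) (hx _))) (max_le_max_right _ (by linarith))
  exact min_sub_min_mono (monotone_cumul hx t.le_succ) hab

lemma progress_sub_le {x y : ℕ → ℝ} (hy : ∀ t, 0 ≤ y t) (hyx : ∀ t, y t ≤ x t) (U : ℕ)
    {a b : ℝ} (hab : a ≤ b) : progress x y U b - progress x y U a ≤ b - a := by
  have hx : ∀ t, 0 ≤ x t := fun t => (hy t).trans (hyx t)
  have hsum : ∑ t ∈ Finset.range U, (y (t + 1) / x (t + 1) *
        (min b (cumul x (t + 1)) - min b (cumul x t)) -
      y (t + 1) / x (t + 1) * (min a (cumul x (t + 1)) - min a (cumul x t))) ≤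
      ∑ t ∈ Finset.range U, ((min b (cumul x (t + 1)) - min a (cumul x (t + 1))) -
        (min b (cumul x t) - min a (cumul x t))) := by
    refine Finset.sum_le_sum fun t _ => ?_
    rw [← mul_sub]
    refine (mul_le_of_le_one_left (sub_nonneg.2
      (min_sub_min_mono (monotone_cumul hx t.le_succ) hab))
      (div_le_one_of_le₀ (hyx _) (hx _))).trans (le_of_eq (by ring))
  rw [Finset.sum_sub_distrib,
    Finset.sum_range_sub fun t => min b (cumul x t) - min a (cumul x t)] at hsum
  have h₀ : 0 ≤ min b (cumul x 0) - min a (cumul x 0) :=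
    sub_nonneg.2 (min_le_min_right _ hab)
  have hmm : ∀ w, min w (cumul x U) + max (w - cumul x U) 0 = w := fun w => by
    rcases le_total w (cumul x U) with h | h
    · rw [min_eq_left h, max_eq_right (by linarith), add_zero]
    · rw [min_eq_right h, max_eq_left (by linarith)]; ring
  unfold progress
  linarith [hmm a, hmm b]

lemma progress_cumul {x y : ℕ → ℝ} (hy : ∀ t, 0 ≤ y t) (hyx : ∀ t, y t ≤ x t) {U t : ℕ}
    (ht : t ≤ U) : progress x y U (cumul x t) = cumul y t := by
  have hx : ∀ t, 0 ≤ x t := fun t => (hy t).trans (hyx t)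
  have hm := monotone_cumul hx
  have hterm : ∀ i ∈ Finset.range U, y (i + 1) / x (i + 1) *
      (min (cumul x t) (cumul x (i + 1)) - min (cumul x t) (cumul x i)) =
      if i < t then y (i + 1) else 0 := fun i _ => by
    split_ifs with h
    · rw [min_eq_right (hm (Nat.succ_le_of_lt h)), min_eq_right (hm h.le), cumul, cumul,
        Finset.sum_range_succ, add_sub_cancel_left]
      rcases (hx (i + 1)).eq_or_lt with h0 | h0
      · rw [← h0, mul_zero]
        exact le_antisymm (hy _) ((hyx _).trans h0.symm.le)
      · exact div_mul_cancel₀ _ h0.ne'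
    · rw [min_eq_left (hm (by omega)), min_eq_left (hm (by omega)), sub_self, mul_zero]
  rw [progress, Finset.sum_congr rfl hterm, max_eq_right (sub_nonpos.2 (hm ht)), add_zero,
    ← Finset.sum_filter, cumul]
  congr 1
  ext i
  simp only [Finset.mem_filter, Finset.mem_range]
  omega

lemma exists_progress_add_one_le {x y : ℕ → ℝ} (hy : ∀ t, 0 ≤ y t) (hyx : ∀ t, y t ≤ x t)
    (U : ℕ) (v : ℝ) : ∃ w, progress x y U v + 1 ≤ progress x y U w := by
  have hx : ∀ t, 0 ≤ x t := fun t => (hy t).trans (hyx t)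
  refine ⟨max v (cumul x U) + 1, ?_⟩
  have hv : v ≤ max v (cumul x U) + 1 := by linarith [le_max_left v (cumul x U)]
  have hsum := Finset.sum_le_sum fun t (_ : t ∈ Finset.range U) => mul_le_mul_of_nonneg_left
    (min_sub_min_mono (monotone_cumul hx t.le_succ) hv) (div_nonneg (hy (t + 1)) (hx (t + 1)))
  have hmax : max (v - cumul x U) 0 + 1 ≤ max (max v (cumul x U) + 1 - cumul x U) 0 := by
    refine le_trans ?_ (le_max_left _ _)
    rcases le_total v (cumul x U) with h | h
    · rw [max_eq_right (sub_nonpos.2 h), max_eq_right h]; linarith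
    · rw [max_eq_left (sub_nonneg.2 h), max_eq_left h]; linarith
  unfold progress
  linarith

/-- Rounding with a gap distribution of parameter `θ` costs a factor of at most `1 / (1 - θ)`. -/
theorem exists_schedule {θ : ℝ} (hθ : 1 / 3 ≤ θ) (hθ' : θ ≤ 1 / 2)
    (hmass : Real.log 2 + 2 - 4 * θ + Real.log (2 * θ) < 1)
    (hmean : Real.log 2 + 3 - 7 * θ + (1 + 4 * θ) * Real.log (2 * θ) ≤ θ)
    {ι : Type*} [Fintype ι] [DecidableEq ι] (U : ℕ) {C : ℝ} (hC : 0 ≤ C) {c : ι → ℝ}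
    (hc : ∀ ρ, 0 ≤ c ρ) (D : Finset (ι × ℕ × ℕ))
    (hD : ∀ d ∈ D, 1 ≤ d.2.1 ∧ d.2.1 ≤ d.2.2 ∧ d.2.2 ≤ U) {x : ℕ → ℝ} {xr : ι → ℕ → ℝ}
    (hxr0 : ∀ ρ t, 0 ≤ xr ρ t) (hx0 : ∀ t, 0 ≤ x t) (hxle : ∀ ρ t, xr ρ t ≤ x t)
    (hsat : ∀ d ∈ D, 1 ≤ ∑ t ∈ Finset.Icc d.2.1 d.2.2, xr d.1 t) :
    ∃ S : Finset (ℕ × Finset ι),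
      (∀ o ∈ S, 1 ≤ o.1 ∧ o.1 ≤ U) ∧
      (∀ d ∈ D, ∃ o ∈ S, d.1 ∈ o.2 ∧ d.2.1 ≤ o.1 ∧ o.1 ≤ d.2.2) ∧
      (∑ o ∈ S, (C + ∑ ρ ∈ o.2, c ρ)) ≤
        (∑ t ∈ Finset.Icc 1 U, (C * x t + ∑ ρ, c ρ * xr ρ t)) / (1 - θ) := by
  have hm := monotone_cumul hx0
  have hcumul_zero : ∀ y : ℕ → ℝ, cumul y 0 = 0 := fun y => by simp [cumul]
  obtain ⟨S, hS, hcost, hcov⟩ := exists_orders hθ hθ' hmass hmean hC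
    ((hcumul_zero x).symm.le.trans (hm U.zero_le)) hc
    (fun ρ => monotone_progress (hxr0 ρ) (hxle ρ) U)
    (fun ρ a b => progress_sub_le (hxr0 ρ) (hxle ρ) U)
    (fun ρ => exists_progress_add_one_le (hxr0 ρ) (hxle ρ) U)
  let time : ℝ → ℕ := fun w => sInf {t | w ≤ cumul x t}
  have htime_le : ∀ w t, w ≤ cumul x t → time w ≤ t := fun w t h => Nat.sInf_le h
  have hlt_time : ∀ w t, w ≤ cumul x U → cumul x t < w → t < time w := fun w t hw h => by
    have hmem : w ≤ cumul x (time w) := Nat.sInf_mem (s := {t | w ≤ cumul x t}) ⟨U, hw⟩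
    exact hm.reflect_lt (h.trans_le hmem)
  refine ⟨S.image fun o => (time o.1, o.2), ?_, ?_, ?_⟩
  · intro o ho
    obtain ⟨p, hp, rfl⟩ := Finset.mem_image.1 ho
    exact ⟨hlt_time _ 0 (hS p hp).2 ((hcumul_zero x).trans_lt (hS p hp).1),
      htime_le _ U (hS p hp).2⟩
  · intro d hd
    obtain ⟨hr, hrd, hdU⟩ := hD d hd
    obtain ⟨o, ho, hmem, hlt, hle⟩ := hcov d.1 (cumul x (d.2.1 - 1)) (cumul x d.2.2)
      ((hcumul_zero x).symm.le.trans (hm (Nat.zero_le _))) (hm hdU) (by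
        rw [progress_cumul (hxr0 _) (hxle _) hdU,
          progress_cumul (hxr0 _) (hxle _) (by omega : d.2.1 - 1 ≤ U),
          ← cumul_add_sum_Icc _ hr hrd]
        linarith [hsat d hd])
    refine ⟨_, Finset.mem_image_of_mem _ ho, hmem, ?_, htime_le _ _ hle⟩
    have := hlt_time o.1 _ (hS o ho).2 hlt
    dsimp only
    omega
  · have hprogress : ∀ ρ, progress x (xr ρ) U (cumul x U) - progress x (xr ρ) U 0 =
        ∑ t ∈ Finset.Icc 1 U, xr ρ t := fun ρ => by
      have h := progress_cumul (hxr0 ρ) (hxle ρ) U.zero_le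
      rw [hcumul_zero, hcumul_zero] at h
      rw [h, sub_zero, progress_cumul (hxr0 ρ) (hxle ρ) le_rfl, cumul_eq_sum_Icc]
    have htotal : C * cumul x U + ∑ ρ, c ρ * (progress x (xr ρ) U (cumul x U) -
        progress x (xr ρ) U 0) = ∑ t ∈ Finset.Icc 1 U, (C * x t + ∑ ρ, c ρ * xr ρ t) := by
      simp only [hprogress]
      rw [cumul_eq_sum_Icc, Finset.sum_add_distrib, Finset.sum_comm (s := Finset.Icc 1 U)]
      simp only [Finset.mul_sum]
    rw [htotal] at hcost
    refine le_trans ?_ hcost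
    exact Finset.sum_image_le_of_nonneg (g := fun o : ℝ × Finset ι => (time o.1, o.2))
      (f := fun o : ℕ × Finset ι => C + ∑ ρ ∈ o.2, c ρ)
      fun o _ => add_nonneg hC (Finset.sum_nonneg fun ρ _ => hc ρ)

end JRPD

/-!
STATEMENT 0: For every JRP-D instance (C, c, D) with times in {1,…,U} and every
feasible fractional solution x of the LP relaxation, there exists a feasible
schedule S with cost(S) ≤ 1.574 · cost(x).
-/

theorem jrpd_integrality_gap_upper_bound_1574
    (m U : ℕ) (C : ℝ) (hC : 0 ≤ C) (c : Fin m → ℝ) (hc : ∀ ρ, 0 ≤ c ρ)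
    (D : Finset (Fin m × ℕ × ℕ))
    (hD : ∀ d ∈ D, 1 ≤ d.2.1 ∧ d.2.1 ≤ d.2.2 ∧ d.2.2 ≤ U)
    (x : ℕ → ℝ) (xr : Fin m → ℕ → ℝ)
    (hxr0 : ∀ ρ t, 0 ≤ xr ρ t) (hx0 : ∀ t, 0 ≤ x t)
    (hxle : ∀ ρ t, xr ρ t ≤ x t)
    (hsat : ∀ d ∈ D, 1 ≤ ∑ t ∈ Finset.Icc d.2.1 d.2.2, xr d.1 t) :
    ∃ S : Finset (ℕ × Finset (Fin m)),
      (∀ o ∈ S, 1 ≤ o.1 ∧ o.1 ≤ U) ∧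
      (∀ d ∈ D, ∃ o ∈ S, d.1 ∈ o.2 ∧ d.2.1 ≤ o.1 ∧ o.1 ≤ d.2.2) ∧
      (∑ o ∈ S, (C + ∑ ρ ∈ o.2, c ρ)) ≤
        1.574 * (∑ t ∈ Finset.Icc 1 U, (C * x t + ∑ ρ, c ρ * xr ρ t)) := by
  have hlog := JRPD.log_574_div_787_le
  have hlog2 := Real.log_two_lt_d9
  obtain ⟨S, hS, hcov, hcost⟩ := JRPD.exists_schedule (θ := 287 / 787) (by norm_num)
    (by norm_num) (by norm_num at hlog hlog2 ⊢; linarith) (by norm_num at hlog hlog2 ⊢; linarith)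
    U hC hc D hD hxr0 hx0 hxle hsat
  refine ⟨S, hS, hcov, hcost.trans (le_of_eq ?_)⟩
  ring
end

section
/- Let θ = 0.36455 and let μ_θ be the probability measure on [0,1] with density f(y) = 0 for y ∈ [0,θ), f(y) = 1/y for y ∈ [θ,2θ), f(y) = (1 − ln((y−θ)/θ))/y for y ∈ [2θ,1), together with an atom at 1 of mass 1 − ∫_0^1 f(y) dy. Then the mean of μ_θ satisfies E[μ_θ] > 0.63533. -/
/-!
STATEMENT 4: Let θ = 0.36455 and μ_θ the probability measure on [0,1] with
density f(y) = 0 on [0,θ), 1/y on [θ,2θ), (1 − ln((y−θ)/θ))/y on [2θ,1),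
together with an atom at 1 of mass 1 − ∫_0^1 f.  Then E[μ_θ] > 0.63533.
-/

open MeasureTheory

noncomputable def jrpTheta : ℝ := 0.36455

/-- The density part of the refined distribution. -/
noncomputable def jrpDensity (y : ℝ) : ℝ :=
  if jrpTheta ≤ y ∧ y < 2 * jrpTheta then 1 / y
  else if 2 * jrpTheta ≤ y ∧ y < 1 then (1 - Real.log ((y - jrpTheta) / jrpTheta)) / y
  else 0

/-- The refined distribution: density `jrpDensity` plus an atom at `1` of mass
`1 − ∫_0^1 jrpDensity`. -/
noncomputable def jrpMu : Measure ℝ :=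
  volume.withDensity (fun y => ENNReal.ofReal (jrpDensity y)) +
    (ENNReal.ofReal (1 - ∫ y in Set.Ioo (0 : ℝ) 1, jrpDensity y)) • Measure.dirac 1

open Set

/-- A degree six polynomial, written around `w = 0`, that minorizes `log (w - 1)` for `2 ≤ w`. -/
noncomputable def logMinorant (w : ℝ) : ℝ :=
  -114570261653 / 7500000000 + 1110841909529 / 40000000000 * w
    - 367161182081 / 16000000000 * w ^ 2 + 130001363393 / 12000000000 * w ^ 3
    - 9507636293 / 3200000000 * w ^ 4 + 17725764297 / 40000000000 * w ^ 5
    - 6696639889 / 240000000000 * w ^ 6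

lemma hasDerivAt_log_sub_logMinorant {w : ℝ} (hw : 1 < w) :
    HasDerivAt (fun w => Real.log (w - 1) - logMinorant w)
      (((1 - 0.95 * (w - 1)) * (1 - 0.73 * (w - 1)) * (1 - 0.59 * (w - 1))) ^ 2 / (w - 1)) w := by
  have hw' : w - 1 ≠ 0 := by linarith
  have hp (n : ℕ) (c : ℝ) : HasDerivAt (fun w : ℝ => c * w ^ n) (c * (n * w ^ (n - 1))) w :=
    (hasDerivAt_pow n w).const_mul c
  have h1 := ((hasDerivAt_id w).sub_const 1).log hw'
  have h2 := ((((((((hasDerivAt_id w).const_mul (1110841909529 / 40000000000)).const_add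
    (-114570261653 / 7500000000)).sub (hp 2 (367161182081 / 16000000000))).add
    (hp 3 (130001363393 / 12000000000))).sub (hp 4 (9507636293 / 3200000000))).add
    (hp 5 (17725764297 / 40000000000))).sub (hp 6 (6696639889 / 240000000000)))
  refine (h1.sub h2).congr_deriv ?_
  simp only [id]
  field_simp
  norm_num
  ring

lemma logMinorant_le_log {w : ℝ} (hw : 2 ≤ w) : logMinorant w ≤ Real.log (w - 1) := by
  have hmono : MonotoneOn (fun w => Real.log (w - 1) - logMinorant w) (Ici 2) := by
    refine monotoneOn_of_hasDerivWithinAt_nonneg (convex_Ici 2)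
      (fun x hx => (hasDerivAt_log_sub_logMinorant
        (one_lt_two.trans_le hx)).continuousAt.continuousWithinAt)
      (fun x hx => (hasDerivAt_log_sub_logMinorant ?_).hasDerivWithinAt) fun x hx => ?_
    all_goals
      rw [interior_Ici] at hx
      have hx : 2 < x := hx
    · linarith
    · exact div_nonneg (sq_nonneg _) (by linarith)
  have h := hmono self_mem_Ici hw hw
  have h2 : Real.log (2 - 1) - logMinorant 2 = 0 := by norm_num [logMinorant]
  simp only [h2] at h
  linarith

lemma jrpDensity_eq_indicator_add (y : ℝ) :
    jrpDensity y = (Ico jrpTheta (2 * jrpTheta)).indicator (fun y => 1 / y) y +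
      (Ico (2 * jrpTheta) 1).indicator
        (fun y => (1 - Real.log ((y - jrpTheta) / jrpTheta)) / y) y := by
  by_cases h1 : jrpTheta ≤ y ∧ y < 2 * jrpTheta
  · simp [jrpDensity, indicator, h1, h1.2.not_ge]
  · by_cases h2 : 2 * jrpTheta ≤ y ∧ y < 1 <;> simp [jrpDensity, indicator, h1, h2]

lemma continuousOn_upper_density :
    ContinuousOn (fun y => (1 - Real.log ((y - jrpTheta) / jrpTheta)) / y)
      (Icc (2 * jrpTheta) 1) := by
  have hθ : 0 < jrpTheta := by norm_num [jrpTheta]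
  refine ContinuousOn.div (continuousOn_const.sub (ContinuousOn.log (by fun_prop) ?_))
    continuousOn_id fun y hy => ?_
  · intro y hy
    exact (div_pos (by linarith [hy.1]) hθ).ne'
  · linarith [hy.1]

lemma continuousOn_lower_density :
    ContinuousOn (fun y : ℝ => 1 / y) (Icc jrpTheta (2 * jrpTheta)) := by
  have hθ : 0 < jrpTheta := by norm_num [jrpTheta]
  exact continuousOn_const.div continuousOn_id fun y hy => by linarith [hy.1]

lemma mul_jrpDensity_eq (φ : ℝ → ℝ) :
    (fun y => φ y * jrpDensity y) = fun y =>
      (Ico jrpTheta (2 * jrpTheta)).indicator (fun y => φ y * (1 / y)) y +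
      (Ico (2 * jrpTheta) 1).indicator
        (fun y => φ y * ((1 - Real.log ((y - jrpTheta) / jrpTheta)) / y)) y := by
  funext y
  simp only [jrpDensity_eq_indicator_add, mul_add, indicator_mul_right]

lemma integrableOn_mul_lower_density {φ : ℝ → ℝ} (hφ : Continuous φ) :
    IntegrableOn (fun y => φ y * (1 / y)) (Ico jrpTheta (2 * jrpTheta)) :=
  ((hφ.continuousOn.mul continuousOn_lower_density).integrableOn_Icc).mono_set Ico_subset_Icc_self

lemma integrableOn_mul_upper_density {φ : ℝ → ℝ} (hφ : Continuous φ) :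
    IntegrableOn (fun y => φ y * ((1 - Real.log ((y - jrpTheta) / jrpTheta)) / y))
      (Ico (2 * jrpTheta) 1) :=
  ((hφ.continuousOn.mul continuousOn_upper_density).integrableOn_Icc).mono_set Ico_subset_Icc_self

lemma integrable_mul_jrpDensity {φ : ℝ → ℝ} (hφ : Continuous φ) :
    Integrable (fun y => φ y * jrpDensity y) := by
  rw [mul_jrpDensity_eq]
  exact ((integrableOn_mul_lower_density hφ).integrable_indicator measurableSet_Ico).add
    ((integrableOn_mul_upper_density hφ).integrable_indicator measurableSet_Ico)

lemma integral_mul_jrpDensity {φ : ℝ → ℝ} (hφ : Continuous φ) :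
    ∫ y, φ y * jrpDensity y = (∫ y in jrpTheta..2 * jrpTheta, φ y * (1 / y)) +
      ∫ y in 2 * jrpTheta..1, φ y * ((1 - Real.log ((y - jrpTheta) / jrpTheta)) / y) := by
  rw [mul_jrpDensity_eq, integral_add
    ((integrableOn_mul_lower_density hφ).integrable_indicator measurableSet_Ico)
    ((integrableOn_mul_upper_density hφ).integrable_indicator measurableSet_Ico),
    integral_indicator measurableSet_Ico, integral_indicator measurableSet_Ico,
    intervalIntegral.integral_of_le (by norm_num [jrpTheta]),
    intervalIntegral.integral_of_le (by norm_num [jrpTheta]),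
    integral_Ico_eq_integral_Ioc, integral_Ico_eq_integral_Ioc]

lemma jrpDensity_nonneg (y : ℝ) : 0 ≤ jrpDensity y := by
  have hθ : 0 < jrpTheta := by norm_num [jrpTheta]
  unfold jrpDensity
  split_ifs with h1 h2
  · exact one_div_nonneg.2 (hθ.le.trans h1.1)
  · refine div_nonneg (sub_nonneg.2 ?_) (by linarith [h2.1])
    have hpos : 0 < (y - jrpTheta) / jrpTheta := div_pos (by linarith [h2.1]) hθ
    have hle : (y - jrpTheta) / jrpTheta ≤ 2 := by
      rw [div_le_iff₀ hθ]
      have := h2.2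
      norm_num [jrpTheta] at this ⊢
      linarith
    linarith [Real.log_le_sub_one_of_pos hpos]
  · exact le_rfl

lemma measurable_jrpDensity : Measurable jrpDensity := by
  rw [funext jrpDensity_eq_indicator_add]
  exact (Measurable.indicator (by fun_prop) measurableSet_Ico).add
    (Measurable.indicator (by fun_prop) measurableSet_Ico)

/-- The mean of `jrpMu` is at least the value it has when the atom is given its signed mass. -/
lemma le_integral_jrpMu :
    1 - ∫ y, (1 - y) * jrpDensity y ≤ ∫ y, y ∂jrpMu := by
  have hmeas : Measurable fun y => ENNReal.ofReal (jrpDensity y) :=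
    measurable_jrpDensity.ennreal_ofReal
  have hsmul : (fun y => (ENNReal.ofReal (jrpDensity y)).toReal • y) =
      fun y => y * jrpDensity y := by
    funext y
    rw [ENNReal.toReal_ofReal (jrpDensity_nonneg y), smul_eq_mul, mul_comm]
  have hfin : ∀ᵐ y : ℝ, ENNReal.ofReal (jrpDensity y) < ⊤ :=
    Filter.Eventually.of_forall fun _ => ENNReal.ofReal_lt_top
  have hint : Integrable (fun y : ℝ => y)
      (volume.withDensity fun y => ENNReal.ofReal (jrpDensity y)) := by
    rw [integrable_withDensity_iff_integrable_smul' hmeas hfin, hsmul]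
    exact integrable_mul_jrpDensity continuous_id
  have hdirac : Integrable (fun y : ℝ => y) (Measure.dirac 1) :=
    integrable_dirac (by simp)
  have hset : ∫ y in Ioo (0 : ℝ) 1, jrpDensity y = ∫ y, jrpDensity y := by
    refine setIntegral_eq_integral_of_forall_compl_eq_zero fun y hy => ?_
    have hθ : 0 < jrpTheta := by norm_num [jrpTheta]
    have hθ' : 2 * jrpTheta < 1 := by norm_num [jrpTheta]
    rw [jrpDensity, if_neg, if_neg]
    · exact fun h => hy ⟨by linarith [h.1], h.2⟩
    · exact fun h => hy ⟨by linarith [h.1], by linarith [h.2]⟩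
  have h1 : Integrable jrpDensity := by
    simpa using integrable_mul_jrpDensity (φ := fun _ => 1) continuous_const
  have hsub : ∫ y, (1 - y) * jrpDensity y = (∫ y, jrpDensity y) - ∫ y, y * jrpDensity y := by
    rw [← integral_sub h1 (integrable_mul_jrpDensity (φ := fun y => y) continuous_id)]
    simp only [sub_mul, one_mul]
  rw [jrpMu, integral_add_measure hint (hdirac.smul_measure ENNReal.ofReal_ne_top),
    integral_withDensity_eq_integral_toReal_smul hmeas hfin, hsmul, integral_smul_measure,
    integral_dirac, smul_eq_mul, mul_one, hset, hsub, ENNReal.toReal_ofReal']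
  linarith [le_max_left (1 - ∫ y, jrpDensity y) 0]

lemma integral_lower_part :
    ∫ y in jrpTheta..2 * jrpTheta, (1 - y) * (1 / y) = Real.log 2 - jrpTheta := by
  have hθ : 0 < jrpTheta := by norm_num [jrpTheta]
  have hpos {y : ℝ} (hy : y ∈ uIcc jrpTheta (2 * jrpTheta)) : 0 < y := by
    rw [uIcc_of_le (by linarith)] at hy
    linarith [hy.1]
  rw [intervalIntegral.integral_eq_sub_of_hasDerivAt (f := fun y => Real.log y - y)]
  · rw [Real.log_mul two_ne_zero hθ.ne']
    ring
  · intro y hy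
    refine ((Real.hasDerivAt_log (hpos hy).ne').sub (hasDerivAt_id y)).congr_deriv ?_
    have := (hpos hy).ne'
    field_simp
  · refine ContinuousOn.intervalIntegrable ?_
    rw [uIcc_of_le (by linarith)]
    exact (continuousOn_const.sub continuousOn_id).mul continuousOn_lower_density

/-- An antiderivative of `w ↦ (1 - θ * w) * ((1 - logMinorant w) / w)`. -/
noncomputable def upperPrimitive (w : ℝ) : ℝ :=
  122070261653 / 7500000000 * Real.log w
    - 5055671438445773 / 150000000000000 * w ^ 1
    + 26457207466425939 / 1600000000000000 * w ^ 2
    - 18431025607097713 / 2880000000000000 * w ^ 3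
    + 1660912662473363 / 960000000000000 * w ^ 4
    - 97681399087463 / 320000000000000 * w ^ 5
    + 454682041358281 / 14400000000000000 * w ^ 6
    - 48825201430699 / 33600000000000000 * w ^ 7

lemma hasDerivAt_upperPrimitive {w : ℝ} (hw : 0 < w) :
    HasDerivAt upperPrimitive ((1 - jrpTheta * w) * ((1 - logMinorant w) / w)) w := by
  have hp (n : ℕ) (c : ℝ) : HasDerivAt (fun w : ℝ => c * w ^ n) (c * (n * w ^ (n - 1))) w :=
    (hasDerivAt_pow n w).const_mul c
  refine (((((((((Real.hasDerivAt_log hw.ne').const_mul (122070261653 / 7500000000)).sub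
    (hp 1 (5055671438445773 / 150000000000000))).add
    (hp 2 (26457207466425939 / 1600000000000000))).sub
    (hp 3 (18431025607097713 / 2880000000000000))).add
    (hp 4 (1660912662473363 / 960000000000000))).sub
    (hp 5 (97681399087463 / 320000000000000))).add
    (hp 6 (454682041358281 / 14400000000000000))).sub
    (hp 7 (48825201430699 / 33600000000000000))).congr_deriv ?_
  simp only [logMinorant, jrpTheta]
  field_simp
  norm_num
  ring

lemma integral_upper_part_le :
    ∫ y in 2 * jrpTheta..1, (1 - y) * ((1 - Real.log ((y - jrpTheta) / jrpTheta)) / y) ≤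
      upperPrimitive (1 / jrpTheta) - upperPrimitive 2 := by
  have hθ : 0 < jrpTheta := by norm_num [jrpTheta]
  have hle : 2 * jrpTheta ≤ 1 := by norm_num [jrpTheta]
  have hderiv {y : ℝ} (hy : y ∈ Icc (2 * jrpTheta) 1) :
      HasDerivAt (fun y => upperPrimitive (y / jrpTheta))
        ((1 - y) * ((1 - logMinorant (y / jrpTheta)) / y)) y := by
    have hy0 : 0 < y := by linarith [hy.1]
    refine ((hasDerivAt_upperPrimitive (div_pos hy0 hθ)).comp y
      ((hasDerivAt_id y).div_const jrpTheta)).congr_deriv ?_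
    field_simp
  have hint : IntervalIntegrable (fun y => (1 - y) * ((1 - logMinorant (y / jrpTheta)) / y))
      volume (2 * jrpTheta) 1 := by
    refine ContinuousOn.intervalIntegrable ?_
    rw [uIcc_of_le hle]
    unfold logMinorant
    exact ContinuousOn.mul (by fun_prop) (ContinuousOn.div (by fun_prop) continuousOn_id
      fun y hy => by linarith [hy.1])
  calc
    _ ≤ ∫ y in 2 * jrpTheta..1, (1 - y) * ((1 - logMinorant (y / jrpTheta)) / y) := by
      refine intervalIntegral.integral_mono_on hle ?_ hint fun y hy => ?_
      · refine ContinuousOn.intervalIntegrable ?_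
        rw [uIcc_of_le hle]
        exact (continuousOn_const.sub continuousOn_id).mul continuousOn_upper_density
      · have hlog := logMinorant_le_log ((le_div_iff₀ hθ).2 hy.1)
        rw [show (y - jrpTheta) / jrpTheta = y / jrpTheta - 1 by field_simp]
        have hy1 : 0 ≤ 1 - y := sub_nonneg.2 hy.2
        have hy0 : 0 < y := by linarith [hy.1]
        gcongr
    _ = upperPrimitive (1 / jrpTheta) - upperPrimitive 2 := by
      rw [intervalIntegral.integral_eq_sub_of_hasDerivAt
        (fun y hy => hderiv (by rwa [uIcc_of_le hle] at hy)) hint, mul_div_cancel_right₀ _ hθ.ne']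

lemma log_inv_theta_sub_log_two_le :
    Real.log (1 / jrpTheta) - Real.log 2 ≤ 0.315945 := by
  have h := Real.log_div_le_sum_range_add (x := 2709 / 17291) (by norm_num) (by norm_num) 4
  rw [← Real.log_div (by norm_num [jrpTheta]) two_ne_zero,
    show 1 / jrpTheta / 2 = (1 + 2709 / 17291) / (1 - 2709 / 17291) by norm_num [jrpTheta]]
  norm_num [Finset.sum_range_succ] at h ⊢
  linarith

theorem jrpMu_mean_gt : (∫ y, y ∂jrpMu) > 0.63533 := by
  have hmean := le_integral_jrpMu
  rw [integral_mul_jrpDensity (by fun_prop), integral_lower_part] at hmean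
  have hupper := integral_upper_part_le
  have hlog := log_inv_theta_sub_log_two_le
  have hlog2 := Real.log_two_lt_d9
  unfold upperPrimitive at hupper
  generalize Real.log (1 / jrpTheta) = a at *
  norm_num [jrpTheta] at *
  linarith
end

section
/- Let (C, c, D) be a JRP-D instance in which every demand period has length exactly 1 (each demand is (ρ, r, r+1) with r ∈ ℝ). For each integer i, let I_i be the sub-instance consisting of the demands whose period [r, r+1] is contained in [i, i+3), and let OPT(I_i) denote the infimum of costs of feasible schedules for I_i (with OPT(I_i) = 0 when I_i has no demands). Then for every feasible schedule S for the full instance, Σ_{i∈ℤ} OPT(I_i) ≤ 3 · cost(S). -/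
/-!
STATEMENT 9: For a JRP-D instance with unit-length demand periods, letting
I_i be the sub-instance of demands whose period [r, r+1] is contained in
[i, i+3) and OPT(I_i) the infimum cost of a feasible schedule for I_i,
every feasible schedule S for the full instance satisfies
Σ_{i ∈ ℤ} OPT(I_i) ≤ 3 · cost(S).
-/

/-- The cost of a schedule. -/
noncomputable def scheduleCost {m : ℕ} (C : ℝ) (c : Fin m → ℝ)
    (S : Finset (ℝ × Finset (Fin m))) : ℝ :=
  ∑ o ∈ S, (C + ∑ ρ ∈ o.2, c ρ)

/-- The optimum cost of the sub-instance `I_i` of a unit-period instance `D`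
(demands recorded as pairs (retailer, release time), with period [r, r+1]):
the infimum of the costs of schedules satisfying all demands whose period
is contained in `[i, i+3)`. -/
noncomputable def subInstanceOpt {m : ℕ} (C : ℝ) (c : Fin m → ℝ)
    (D : Finset (Fin m × ℝ)) (i : ℤ) : ℝ :=
  sInf {y : ℝ | ∃ S : Finset (ℝ × Finset (Fin m)),
    (∀ d ∈ D, ((i : ℝ) ≤ d.2 ∧ d.2 + 1 < (i : ℝ) + 3) →
      ∃ o ∈ S, d.1 ∈ o.2 ∧ d.2 ≤ o.1 ∧ o.1 ≤ d.2 + 1) ∧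
    y = scheduleCost C c S}

theorem scheduleCost_nonneg {m : ℕ} {C : ℝ} (hC : 0 ≤ C) {c : Fin m → ℝ} (hc : ∀ ρ, 0 ≤ c ρ)
    (S : Finset (ℝ × Finset (Fin m))) : 0 ≤ scheduleCost C c S :=
  Finset.sum_nonneg fun _ _ => add_nonneg hC (Finset.sum_nonneg fun ρ _ => hc ρ)

theorem subInstanceOpt_nonneg {m : ℕ} {C : ℝ} (hC : 0 ≤ C) {c : Fin m → ℝ} (hc : ∀ ρ, 0 ≤ c ρ)
    (D : Finset (Fin m × ℝ)) (i : ℤ) : 0 ≤ subInstanceOpt C c D i := by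
  apply Real.sInf_nonneg
  rintro y ⟨S, -, rfl⟩
  exact scheduleCost_nonneg hC hc S

/-- The orders of a feasible schedule placed in `[i, i+3)` serve all of `I_i`. -/
theorem subInstanceOpt_le_scheduleCost_filter {m : ℕ} {C : ℝ} (hC : 0 ≤ C) {c : Fin m → ℝ}
    (hc : ∀ ρ, 0 ≤ c ρ) {D : Finset (Fin m × ℝ)} {S : Finset (ℝ × Finset (Fin m))}
    (hfeas : ∀ d ∈ D, ∃ o ∈ S, d.1 ∈ o.2 ∧ d.2 ≤ o.1 ∧ o.1 ≤ d.2 + 1) (i : ℤ) :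
    subInstanceOpt C c D i ≤
      scheduleCost C c (S.filter fun o => i ∈ Finset.Icc (⌊o.1⌋ - 2) ⌊o.1⌋) := by
  refine csInf_le ⟨0, ?_⟩ ⟨_, fun d hd hdi => ?_, rfl⟩
  · rintro y ⟨S, -, rfl⟩
    exact scheduleCost_nonneg hC hc S
  · obtain ⟨o, ho, hρ, hr, hl⟩ := hfeas d hd
    have h_floor : ⌊o.1⌋ < i + 3 := Int.floor_lt.2 (by push_cast; linarith [hdi.2])
    exact ⟨o, Finset.mem_filter.2 ⟨ho, Finset.mem_Icc.2
      ⟨by lia, Int.le_floor.2 (hdi.1.trans hr)⟩⟩, hρ, hr, hl⟩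

theorem sum_subinstance_opt_le_three_cost
    (m : ℕ) (C : ℝ) (hC : 0 ≤ C) (c : Fin m → ℝ) (hc : ∀ ρ, 0 ≤ c ρ)
    (D : Finset (Fin m × ℝ))
    (S : Finset (ℝ × Finset (Fin m)))
    (hfeas : ∀ d ∈ D, ∃ o ∈ S, d.1 ∈ o.2 ∧ d.2 ≤ o.1 ∧ o.1 ≤ d.2 + 1) :
    ∑' i : ℤ, subInstanceOpt C c D i ≤ 3 * scheduleCost C c S := by
  set T : Finset ℤ := S.biUnion fun o => Finset.Icc (⌊o.1⌋ - 2) ⌊o.1⌋ with hT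
  have h_zero : ∀ i ∉ T, subInstanceOpt C c D i = 0 := fun i hi => by
    refine le_antisymm ?_ (subInstanceOpt_nonneg hC hc D i)
    refine (subInstanceOpt_le_scheduleCost_filter hC hc hfeas i).trans_eq ?_
    rw [Finset.filter_eq_empty_iff.2 fun o ho h => hi (Finset.mem_biUnion.2 ⟨o, ho, h⟩)]
    exact Finset.sum_empty
  rw [tsum_eq_sum h_zero]
  calc ∑ i ∈ T, subInstanceOpt C c D i
      ≤ ∑ i ∈ T, ∑ o ∈ S with i ∈ Finset.Icc (⌊o.1⌋ - 2) ⌊o.1⌋, (C + ∑ ρ ∈ o.2, c ρ) :=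
        Finset.sum_le_sum fun i _ => subInstanceOpt_le_scheduleCost_filter hC hc hfeas i
    _ = ∑ o ∈ S, ∑ i ∈ Finset.Icc (⌊o.1⌋ - 2) ⌊o.1⌋, (C + ∑ ρ ∈ o.2, c ρ) := by
        refine Finset.sum_comm' fun i o => ?_
        simp only [Finset.mem_filter, hT, Finset.mem_biUnion]
        exact ⟨fun h => ⟨h.2.2, h.2.1⟩, fun h => ⟨⟨o, h.2, h.1⟩, h.2, h.1⟩⟩
    _ = 3 * scheduleCost C c S := by
        rw [scheduleCost, Finset.mul_sum]
        refine Finset.sum_congr rfl fun o _ => ?_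
        have h_card : (Finset.Icc (⌊o.1⌋ - 2) ⌊o.1⌋).card = 3 := by
          rw [Int.card_Icc]
          lia
        rw [Finset.sum_const, h_card, nsmul_eq_mul, Nat.cast_ofNat]
end

section
/- Fix U > √2 and consider the continuous-time JRP-D instance with warehouse ordering cost C = 1 and two retailers with ordering costs c_1 = 0 and c_2 = √2, whose demand set is { (1, t, t+1) : t ∈ [0, U−√2] } ∪ { (2, t, t+√2) : t ∈ [0, U−√2] }. Then every feasible schedule for this instance has cost at least (1+√2)(U − √2). -/
/-!
STATEMENT 11: For the continuous-time instance with C = 1, retailer 0 of cost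
0 with demand periods [t, t+1] and retailer 1 of cost √2 with demand periods
[t, t+√2], for all t ∈ [0, U−√2], every feasible schedule has cost at least
(1+√2)(U − √2).
-/

lemma orderCost_nonneg (R : Finset (Fin 2)) :
    0 ≤ ∑ ρ ∈ R, if ρ = 1 then Real.sqrt 2 else 0 :=
  Finset.sum_nonneg fun ρ _ => by split_ifs <;> positivity

lemma sqrt_two_le_orderCost {R : Finset (Fin 2)} (h : 1 ∈ R) :
    Real.sqrt 2 ≤ ∑ ρ ∈ R, if ρ = 1 then Real.sqrt 2 else 0 := by
  rw [Finset.sum_ite_eq' R 1 (fun _ => Real.sqrt 2), if_pos h]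

/-- The orders strictly after time `x` cost at least `(1 + √2) (L - x)`. -/
lemma cost_after_lower_bound (L : ℝ) (S : Finset (ℝ × Finset (Fin 2)))
    (w : ℝ × Finset (Fin 2) → ℝ) (hw : ∀ o, 1 ≤ w o)
    (hw₁ : ∀ o, 1 ∈ o.2 → 1 + Real.sqrt 2 ≤ w o)
    (hfeas₀ : ∀ t ∈ Set.Icc (0 : ℝ) L, ∃ o ∈ S, (0 : Fin 2) ∈ o.2 ∧ t ≤ o.1 ∧ o.1 ≤ t + 1)
    (hfeas₁ : ∀ t ∈ Set.Icc (0 : ℝ) L,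
      ∃ o ∈ S, (1 : Fin 2) ∈ o.2 ∧ t ≤ o.1 ∧ o.1 ≤ t + Real.sqrt 2)
    (n : ℕ) (x : ℝ) (hx : 0 ≤ x) (hn : (S.filter (x < ·.1)).card ≤ n) :
    (1 + Real.sqrt 2) * (L - x) ≤ ∑ o ∈ S.filter (x < ·.1), w o := by
  have hs : Real.sqrt 2 * Real.sqrt 2 = 2 := Real.mul_self_sqrt (by norm_num)
  have hs₀ : 0 ≤ Real.sqrt 2 := Real.sqrt_nonneg 2
  have hw₀ : ∀ o, 0 ≤ w o := fun o => zero_le_one.trans (hw o)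
  induction n generalizing x with
  | zero =>
    have hempty := Finset.card_eq_zero.mp (Nat.le_zero.mp hn)
    rcases le_or_gt L x with hL | hL
    · rw [hempty, Finset.sum_empty]
      exact mul_nonpos_of_nonneg_of_nonpos (by linarith) (by linarith)
    · obtain ⟨o, ho, -, hoL, -⟩ := hfeas₁ L ⟨hx.trans hL.le, le_rfl⟩
      exact absurd (hL.trans_le hoL) (Finset.filter_eq_empty_iff.mp hempty ho)
  | succ n ih =>
    rcases le_or_gt L x with hL | hL
    · exact (mul_nonpos_of_nonneg_of_nonpos (by linarith) (by linarith)).trans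
        (Finset.sum_nonneg fun o _ => hw₀ o)
    obtain ⟨o, ho, ho₁, hoL, -⟩ := hfeas₁ L ⟨hx.trans hL.le, le_rfl⟩
    obtain ⟨b, hb, hmin⟩ := Finset.exists_min_image
      (S.filter fun o => x < o.1 ∧ 1 ∈ o.2) Prod.fst
      ⟨o, Finset.mem_filter.mpr ⟨ho, hL.trans_le hoL, ho₁⟩⟩
    obtain ⟨hbS, hxb, hb₁⟩ := Finset.mem_filter.mp hb
    have hgap : b.1 ≤ x + Real.sqrt 2 := by
      by_contra! h
      obtain ⟨t, hxt, ht⟩ := exists_between (lt_min hL (lt_sub_iff_add_lt.mpr h))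
      obtain ⟨htL, htb⟩ := lt_min_iff.mp ht
      obtain ⟨p, hp, hp₁, htp, hpt⟩ := hfeas₁ t ⟨by linarith, htL.le⟩
      have := hmin p (Finset.mem_filter.mpr ⟨hp, by linarith, hp₁⟩)
      linarith
    have hbn : b ∉ S.filter (b.1 < ·.1) := by simp
    have hsub : insert b (S.filter (b.1 < ·.1)) ⊆ S.filter (x < ·.1) := by
      refine Finset.insert_subset (Finset.mem_filter.mpr ⟨hbS, hxb⟩) fun p hp => ?_
      obtain ⟨hpS, hbp⟩ := Finset.mem_filter.mp hp
      exact Finset.mem_filter.mpr ⟨hpS, hxb.trans hbp⟩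
    have hcard := Finset.card_le_card hsub
    rw [Finset.card_insert_of_notMem hbn] at hcard
    have hrec := ih b.1 (hx.trans hxb.le) (by omega)
    have hwb := hw₁ b hb₁
    rcases le_or_gt b.1 (x + 1) with h | h
    · have hsum := Finset.sum_le_sum_of_subset_of_nonneg hsub fun o _ _ => hw₀ o
      rw [Finset.sum_insert hbn] at hsum
      nlinarith
    · obtain ⟨t, hxt, ht⟩ := exists_between (lt_min hL (lt_sub_iff_add_lt.mpr h))
      obtain ⟨htL, htb⟩ := lt_min_iff.mp ht
      obtain ⟨a, ha, -, hta, hat⟩ := hfeas₀ t ⟨by linarith, htL.le⟩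
      have hab : a.1 < b.1 := by linarith
      have han : a ∉ insert b (S.filter (b.1 < ·.1)) := by
        rw [Finset.mem_insert, Finset.mem_filter]
        rintro (rfl | ⟨-, hba⟩)
        · exact hab.false
        · exact hab.asymm hba
      have hsum := Finset.sum_le_sum_of_subset_of_nonneg
        (Finset.insert_subset (Finset.mem_filter.mpr ⟨ha, by linarith⟩) hsub)
        fun o _ _ => hw₀ o
      rw [Finset.sum_insert han, Finset.sum_insert hbn] at hsum
      have hwa := hw a
      nlinarith

theorem two_retailer_lower_bound
    (U : ℝ) (hU : Real.sqrt 2 < U)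
    (S : Finset (ℝ × Finset (Fin 2)))
    (hfeas₀ : ∀ t ∈ Set.Icc (0 : ℝ) (U - Real.sqrt 2),
      ∃ o ∈ S, (0 : Fin 2) ∈ o.2 ∧ t ≤ o.1 ∧ o.1 ≤ t + 1)
    (hfeas₁ : ∀ t ∈ Set.Icc (0 : ℝ) (U - Real.sqrt 2),
      ∃ o ∈ S, (1 : Fin 2) ∈ o.2 ∧ t ≤ o.1 ∧ o.1 ≤ t + Real.sqrt 2) :
    (1 + Real.sqrt 2) * (U - Real.sqrt 2) ≤
      ∑ o ∈ S, (1 + ∑ ρ ∈ o.2, if ρ = 1 then Real.sqrt 2 else 0) := by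
  set w : ℝ × Finset (Fin 2) → ℝ :=
    fun o => 1 + ∑ ρ ∈ o.2, if ρ = 1 then Real.sqrt 2 else 0
  have hw : ∀ o, 1 ≤ w o := fun o => le_add_of_nonneg_right (orderCost_nonneg o.2)
  have hw₁ : ∀ o, 1 ∈ o.2 → 1 + Real.sqrt 2 ≤ w o := fun o ho =>
    add_le_add_right (sqrt_two_le_orderCost ho) 1
  have h := cost_after_lower_bound (U - Real.sqrt 2) S w hw hw₁ hfeas₀ hfeas₁ _ 0 le_rfl le_rfl
  rw [sub_zero] at h
  exact h.trans (Finset.sum_le_sum_of_subset_of_nonneg (Finset.filter_subset _ S)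
    fun o _ _ => zero_le_one.trans (hw o))
end

section
/- For every ε > 0 there exist a continuous-time JRP-D instance (C, c, D) with times in [0, U] and a feasible fractional solution x of its continuous-time LP relaxation such that every feasible schedule for the instance has cost at least ((1+√2)/2 − ε) · cost(x). In particular, the integrality gap of the LP relaxation of JRP-D is at least (1+√2)/2 ≥ 1.207. -/
/-!
STATEMENT 12: For every ε > 0 there is a continuous-time JRP-D instance and a
feasible fractional solution x of its continuous-time LP relaxation such that
every feasible schedule has cost at least ((1+√2)/2 − ε)·cost(x).  In
particular, the integrality gap of the LP relaxation is at least
(1+√2)/2 ≥ 1.207.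
-/

open Finset in
/-- If the first retailer is ordered in every window of length `1` and the second one, of cost `√2`,
in every window of length `√2`, then the orders up to time `p` of an order of the second retailer
cost at least `(1 + √2) p`: a gap between consecutive orders of the second retailer has length at
most `1`, or contains an additional order and has length at most `√2`. -/
theorem mul_le_sum_orders_le (S : Finset (ℝ × Finset (Fin 2))) (U : ℝ)
    (h₀ : ∀ s, 0 ≤ s → s + 1 ≤ U → ∃ o ∈ S, 0 ∈ o.2 ∧ s ≤ o.1 ∧ o.1 ≤ s + 1)
    (h₁ : ∀ s, 0 ≤ s → s + √2 ≤ U → ∃ o ∈ S, 1 ∈ o.2 ∧ s ≤ o.1 ∧ o.1 ≤ s + √2)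
    {o : ℝ × Finset (Fin 2)} (ho : o ∈ S) (hρ : 1 ∈ o.2) (hU : o.1 ≤ U) :
    (1 + √2) * o.1 ≤ ∑ o' ∈ S with o'.1 ≤ o.1, (1 + ∑ ρ ∈ o'.2, ![0, √2] ρ) := by
  set cost : ℝ × Finset (Fin 2) → ℝ := fun o' => 1 + ∑ ρ ∈ o'.2, ![0, √2] ρ with hcost
  have hsq : √2 * √2 = 2 := Real.mul_self_sqrt (by norm_num)
  have hpos : 0 < √2 := by positivity
  have hc : ∀ ρ : Fin 2, 0 ≤ ![0, √2] ρ := by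
    intro ρ
    fin_cases ρ <;> simp
  have hcost_one : ∀ o', 1 ≤ cost o' := fun o' =>
    le_add_of_nonneg_right (sum_nonneg fun ρ _ => hc ρ)
  have hcost_two : ∀ o' : ℝ × Finset (Fin 2), 1 ∈ o'.2 → 1 + √2 ≤ cost o' := by
    intro o' h
    have := single_le_sum (f := ![0, √2]) (fun ρ _ => hc ρ) h
    simpa [hcost] using this
  have hcost_nonneg : ∀ o', 0 ≤ cost o' := fun o' => zero_le_one.trans (hcost_one o')
  by_contra hlt
  obtain ⟨o, hmem, hmin⟩ := exists_min_image
    {o' ∈ S | 1 ∈ o'.2 ∧ o'.1 ≤ U ∧ ∑ b ∈ S with b.1 ≤ o'.1, cost b < (1 + √2) * o'.1} Prod.fst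
    ⟨o, mem_filter.2 ⟨ho, hρ, hU, not_le.1 hlt⟩⟩
  obtain ⟨ho, hρ, hU, hlt⟩ := mem_filter.1 hmem
  have hp : 0 < o.1 := by
    have := sum_nonneg (s := {b ∈ S | b.1 ≤ o.1}) fun b _ => hcost_nonneg b
    nlinarith
  obtain ⟨q, hq₀, hqp, hq, hgap⟩ : ∃ q, 0 ≤ q ∧ q < o.1 ∧
      (1 + √2) * q ≤ ∑ b ∈ S with b.1 ≤ q, cost b ∧
      ∀ b ∈ S, 1 ∈ b.2 → q < b.1 → o.1 ≤ b.1 := by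
    by_cases hne : ({b ∈ S | 1 ∈ b.2 ∧ 0 ≤ b.1 ∧ b.1 < o.1} : Finset _).Nonempty
    · obtain ⟨a, ha, hmax⟩ := exists_max_image _ Prod.fst hne
      simp only [mem_filter] at ha hmax hmin
      refine ⟨a.1, ha.2.2.1, ha.2.2.2, ?_, fun b hb hbρ hab => ?_⟩
      · by_contra hcon
        exact (hmin a ⟨ha.1, ha.2.1, ha.2.2.2.le.trans hU, not_le.1 hcon⟩).not_gt ha.2.2.2
      · by_contra hcon
        exact (hmax b ⟨hb, hbρ, ha.2.2.1.trans hab.le, not_le.1 hcon⟩).not_gt hab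
    · refine ⟨0, le_rfl, hp, ?_, fun b hb hbρ hb₀ => ?_⟩
      · rw [mul_zero]
        exact sum_nonneg fun b _ => hcost_nonneg b
      · by_contra hcon
        exact hne ⟨b, mem_filter.2 ⟨hb, hbρ, hb₀.le, not_le.1 hcon⟩⟩
  have hlen : o.1 - q ≤ √2 := by
    by_contra! hcon
    obtain ⟨b, hb, hbρ, hb₁, hb₂⟩ := h₁ ((q + (o.1 - √2)) / 2) (by linarith) (by linarith)
    linarith [hgap b hb hbρ (by linarith)]
  have ho_notMem : o ∉ ({b ∈ S | b.1 ≤ q} : Finset _) := by simp [hqp]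
  by_cases hshort : o.1 - q ≤ 1
  · have hsub : insert o {b ∈ S | b.1 ≤ q} ⊆ ({b ∈ S | b.1 ≤ o.1} : Finset _) := by
      intro b
      simp only [mem_insert, mem_filter]
      rintro (rfl | h)
      exacts [⟨ho, le_rfl⟩, ⟨h.1, h.2.trans hqp.le⟩]
    have hsum := sum_le_sum_of_subset_of_nonneg hsub fun b _ _ => hcost_nonneg b
    rw [sum_insert ho_notMem] at hsum
    nlinarith [hcost_two o hρ]
  · obtain ⟨a, ha, -, ha₁, ha₂⟩ := h₀ ((q + (o.1 - 1)) / 2) (by linarith) (by linarith)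
    have haq : q < a.1 := by linarith
    have hap : a.1 < o.1 := by linarith
    have hsub : insert a (insert o {b ∈ S | b.1 ≤ q}) ⊆ ({b ∈ S | b.1 ≤ o.1} : Finset _) := by
      intro b
      simp only [mem_insert, mem_filter]
      rintro (rfl | rfl | h)
      exacts [⟨ha, hap.le⟩, ⟨ho, le_rfl⟩, ⟨h.1, h.2.trans hqp.le⟩]
    have ha_notMem : a ∉ insert o ({b ∈ S | b.1 ≤ q} : Finset _) := by
      simp only [mem_insert, mem_filter, not_or, not_and, not_le]
      exact ⟨fun h => hap.ne (congrArg Prod.fst h), fun _ => haq⟩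
    have hsum := sum_le_sum_of_subset_of_nonneg hsub fun b _ _ => hcost_nonneg b
    rw [sum_insert ha_notMem, sum_insert ho_notMem] at hsum
    nlinarith [hcost_two o hρ, hcost_one a]

theorem jrpd_integrality_gap_lower_bound :
    (∀ ε : ℝ, 0 < ε →
      ∃ (m : ℕ) (C : ℝ) (c : Fin m → ℝ) (U : ℝ) (D : Set (Fin m × ℝ × ℝ))
        (x : ℝ → ℝ) (xr : Fin m → ℝ → ℝ),
        0 ≤ C ∧ (∀ ρ, 0 ≤ c ρ) ∧ 0 ≤ U ∧
        (∀ d ∈ D, 0 ≤ d.2.1 ∧ d.2.1 ≤ d.2.2 ∧ d.2.2 ≤ U) ∧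
        Measurable x ∧ (∀ ρ, Measurable (xr ρ)) ∧
        (∀ t, 0 ≤ x t) ∧ (∀ ρ t, 0 ≤ xr ρ t ∧ xr ρ t ≤ x t) ∧
        (∀ d ∈ D, 1 ≤ ∫ t in d.2.1..d.2.2, xr d.1 t) ∧
        0 < (∫ t in (0:ℝ)..U, (C * x t + ∑ ρ, c ρ * xr ρ t)) ∧
        ∀ S : Finset (ℝ × Finset (Fin m)),
          (∀ d ∈ D, ∃ o ∈ S, d.1 ∈ o.2 ∧ d.2.1 ≤ o.1 ∧ o.1 ≤ d.2.2) →
          ((1 + Real.sqrt 2) / 2 - ε) *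
              (∫ t in (0:ℝ)..U, (C * x t + ∑ ρ, c ρ * xr ρ t)) ≤
            ∑ o ∈ S, (C + ∑ ρ ∈ o.2, c ρ)) ∧
    (1.207 : ℝ) ≤ (1 + Real.sqrt 2) / 2 := by
  have hsq : √2 * √2 = 2 := Real.mul_self_sqrt (by norm_num)
  have hlow : (1.414 : ℝ) ≤ √2 := Real.le_sqrt_of_sq_le (by norm_num)
  have hhigh : √2 ≤ 3 / 2 := (Real.sqrt_le_left (by norm_num)).2 (by norm_num)
  refine ⟨fun ε hε => ?_, by linarith⟩
  obtain ⟨U, hU₂, hεU⟩ : ∃ U : ℝ, 2 ≤ U ∧ 4 ≤ 2 * ε * U := by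
    refine ⟨2 + 2 / ε, by linarith [div_pos two_pos hε], ?_⟩
    have : ε * (2 / ε) = 2 := mul_div_cancel₀ 2 hε.ne'
    nlinarith
  have hint : ∫ t in (0 : ℝ)..U, ((1 : ℝ) * 1 + ∑ ρ : Fin 2, ![0, √2] ρ * ![1, (√2)⁻¹] ρ)
      = 2 * U := by
    simp
    ring
  refine ⟨2, 1, ![0, √2], U, {d | 0 ≤ d.2.1 ∧ d.2.2 ≤ U ∧ d.2.2 = d.2.1 + ![1, √2] d.1},
    fun _ => 1, fun ρ _ => ![1, (√2)⁻¹] ρ, zero_le_one, ?_, by linarith, ?_, measurable_const,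
    fun _ => measurable_const, fun _ => zero_le_one, ?_, ?_, ?_, ?_⟩
  · intro ρ
    fin_cases ρ <;> simp
  · rintro ⟨ρ, r, d⟩ ⟨hr, hd, heq⟩
    refine ⟨hr, ?_, hd⟩
    fin_cases ρ <;> simp at heq ⊢ <;> linarith
  · intro ρ _
    fin_cases ρ
    · simp
    · simp only [Fin.mk_one, Matrix.cons_val_one, Matrix.cons_val_fin_one]
      exact ⟨by positivity, inv_le_one_of_one_le₀ (by linarith)⟩
  · rintro ⟨ρ, r, d⟩ ⟨-, -, heq⟩
    fin_cases ρ <;> simp at heq <;> simp [heq]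
  · rw [hint]
    linarith
  · intro S hS
    rw [hint]
    have h₀ : ∀ s, 0 ≤ s → s + 1 ≤ U → ∃ o ∈ S, 0 ∈ o.2 ∧ s ≤ o.1 ∧ o.1 ≤ s + 1 :=
      fun s hs hsU => hS (0, s, s + 1) ⟨hs, hsU, rfl⟩
    have h₁ : ∀ s, 0 ≤ s → s + √2 ≤ U → ∃ o ∈ S, 1 ∈ o.2 ∧ s ≤ o.1 ∧ o.1 ≤ s + √2 :=
      fun s hs hsU => hS (1, s, s + √2) ⟨hs, hsU, rfl⟩
    obtain ⟨o, ho, hρ, hlo, hhi⟩ := h₁ (U - √2) (by linarith) (by linarith)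
    have hbound := mul_le_sum_orders_le S U h₀ h₁ ho hρ (by linarith)
    have hsub := Finset.sum_le_sum_of_subset_of_nonneg (Finset.filter_subset (·.1 ≤ o.1) S)
      (f := fun o' => 1 + ∑ ρ ∈ o'.2, ![0, √2] ρ) fun b _ _ =>
        add_nonneg zero_le_one (Finset.sum_nonneg fun ρ _ => by fin_cases ρ <;> simp)
    refine le_trans ?_ (hbound.trans hsub)
    nlinarith
end

section
/- There is a constant c ≥ 0 (independent of K) such that the following holds for every positive integer K divisible by 3. Consider the continuous-time JRP-D instance D_K with warehouse ordering cost C = 1 and three retailers 0, 1, 2, each with ordering cost 1/3, where for each ρ ∈ {0,1,2} and each i ∈ {0, 1, …, K/3}, retailer ρ has one demand with closed period [3i+ρ, 3i+2+ρ] and one demand with open period (3i − 3/2 + ρ, 3i + 1/2 + ρ) (an order at time t satisfies a demand of retailer ρ with open period (a,b) if ρ participates in the order and a < t < b). Then every feasible schedule for D_K has cost at least K − c. -/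
/-- The half-integer cell of a time `t`: the cell `2 * k` for `t = k / 2`, and the odd cell
between two consecutive even cells for `t` strictly between two consecutive half-integers. -/
noncomputable def timeCell (t : ℝ) : ℤ := ⌊2 * t⌋ + ⌈2 * t⌉

theorem le_timeCell {t : ℝ} {a : ℤ} (h : (a : ℝ) ≤ 2 * t) : 2 * a ≤ timeCell t := by
  have h₁ : a ≤ ⌊2 * t⌋ := Int.le_floor.2 h
  have h₂ := Int.floor_le_ceil (2 * t)
  unfold timeCell
  omega

theorem timeCell_le {t : ℝ} {a : ℤ} (h : 2 * t ≤ a) : timeCell t ≤ 2 * a := by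
  have h₁ : ⌈2 * t⌉ ≤ a := Int.ceil_le.2 h
  have h₂ := Int.floor_le_ceil (2 * t)
  unfold timeCell
  omega

theorem lt_timeCell {t : ℝ} {a : ℤ} (h : (a : ℝ) < 2 * t) : 2 * a < timeCell t := by
  have h₁ : a < ⌈2 * t⌉ := Int.lt_ceil.2 h
  have h₂ : a ≤ ⌊2 * t⌋ := Int.le_floor.2 h.le
  unfold timeCell
  omega

theorem timeCell_lt {t : ℝ} {a : ℤ} (h : 2 * t < a) : timeCell t < 2 * a := by
  have h₁ : ⌊2 * t⌋ < a := Int.floor_lt.2 h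
  have h₂ : ⌈2 * t⌉ ≤ a := Int.ceil_le.2 h.le
  unfold timeCell
  omega

/-- Three times the cost of a single order, given the participation of each retailer. -/
def orderCost (a b d : Bool) : ℕ :=
  if a || b || d then 3 + (a.toNat + b.toNat + d.toNat) else 0

theorem orderCost_rotate (a b d : Bool) : orderCost b d a = orderCost a b d := by
  revert a b d
  decide

theorem orderCost_mem (U : Finset (Fin 3)) :
    orderCost (decide (0 ∈ U)) (decide (1 ∈ U)) (decide (2 ∈ U)) =
      if U = ∅ then 0 else 3 + U.card := by
  revert U
  decide

/-- A retailer ordering at the cells where `f` is true has not ordered in `[a, n)`. -/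
noncomputable def pending (f : ℤ → Bool) (a n : ℤ) : Bool :=
  open Classical in decide (∀ m, a ≤ m → m < n → f m = false)

theorem pending_self (f : ℤ → Bool) (a : ℤ) : pending f a a = true := by
  simp only [pending, decide_eq_true_eq]
  intro m h₁ h₂
  omega

theorem pending_succ (f : ℤ → Bool) {a n : ℤ} (h : a ≤ n) :
    pending f a (n + 1) = (pending f a n && !f n) := by
  rw [Bool.eq_iff_iff]
  simp only [pending, decide_eq_true_eq, Bool.and_eq_true, Bool.not_eq_true']
  constructor
  · exact fun H => ⟨fun m h₁ h₂ => H m h₁ (by omega), H n h (by omega)⟩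
  · rintro ⟨H, H'⟩ m h₁ h₂
    rcases eq_or_ne m n with rfl | hne
    · exact H'
    · exact H m h₁ (by omega)

theorem pending_mono (f : ℤ → Bool) {a b n : ℤ} (h : a ≤ b) :
    pending f a n = true → pending f b n = true := by
  simp only [pending, decide_eq_true_eq]
  exact fun H m h₁ h₂ => H m (by omega) h₂

theorem pending_eq_false {f : ℤ → Bool} {a b n m : ℤ} (h : f m = true) (h₁ : a ≤ m)
    (h₂ : m ≤ b) (hb : b + 1 = n) : pending f a n = false := by
  simp only [pending, decide_eq_false_iff_not]
  intro H
  simp [H m h₁ (by omega)] at h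

/-- The debt at the beginning of a time unit, when the first retailer may have a pending open
demand, the second has `cB` and `oB` telling whether its current closed and open demands are
pending, and the third may have a pending closed demand. -/
def startDebt (oA cB oB cD : Bool) : ℕ :=
  match oA, cB.toNat + oB.toNat, cD with
  | false, 0, false => 0
  | false, 0, true => 1
  | false, 1, _ => 3
  | false, _, _ => 4
  | true, 0, false => 1
  | true, 0, true => 2
  | true, 1, false => 4
  | true, 1, true => 6
  | true, _, false => 5
  | true, _, true => 6

/-- The debt inside a time unit. -/
def innerDebt (oA cA oB cD : Bool) : ℕ :=
  match oA.toNat + cA.toNat, oB, cD with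
  | 0, false, false => 0
  | 1, false, false => 0
  | _, false, false => 1
  | 0, false, true => 1
  | 1, false, true => 1
  | _, false, true => 2
  | 0, true, false => 1
  | 1, true, false => 3
  | _, true, false => 4
  | 0, true, true => 2
  | 1, true, true => 3
  | _, true, true => 6

theorem startDebt_le (oA cB oB cD : Bool) : startDebt oA cB oB cD ≤ 6 := by
  revert oA cB oB cD
  decide

theorem startDebt_le_innerDebt (oA cB oB cD a b d : Bool) (h : cB = true → oB = true)
    (hB : (cB && !b) = false) :
    startDebt oA cB oB cD ≤
      orderCost a b d + innerDebt (oA && !a) (true && !a) (oB && !b) (cD && !d) := by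
  revert oA cB oB cD a b d
  decide

theorem innerDebt_le_innerDebt (oA cA oB cD a b d : Bool) (h : oA = true → cA = true) :
    innerDebt oA cA oB cD ≤
      orderCost a b d + innerDebt (oA && !a) (cA && !a) (oB && !b) (cD && !d) := by
  revert oA cA oB cD a b d
  decide

theorem innerDebt_le_startDebt (cA oB cD a b d : Bool) :
    3 + innerDebt false cA oB cD ≤
      orderCost a b d + startDebt (oB && !b) (cD && !d) (true && !d) (cA && !a) := by
  revert cA oB cD a b d
  decide

/-- The debt at cell `n`, for retailers ordering according to `f`, `g`, `h`, whose closed demands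
start at cells congruent to `n`, `n + 4`, `n + 8` modulo `12`, respectively. -/
noncomputable def debt (f g h : ℤ → Bool) (n : ℤ) : ℕ :=
  startDebt (pending f (n - 5) n) (pending g (n - 8) n) (pending g (n - 1) n)
    (pending h (n - 4) n)

theorem debt_le_unit (f g h : ℤ → Bool) (n : ℤ) (hg : pending g (n - 8) (n + 1) = false)
    (hf : pending f (n - 5) (n + 2) = false) :
    3 + debt f g h n ≤ orderCost (f n) (g n) (h n) + orderCost (f (n + 1)) (g (n + 1)) (h (n + 1))
      + orderCost (f (n + 2)) (g (n + 2)) (h (n + 2))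
      + orderCost (f (n + 3)) (g (n + 3)) (h (n + 3)) + debt g h f (n + 4) := by
  have e₂ : n + 2 = n + 1 + 1 := by ring
  have e₃ : n + 3 = n + 1 + 1 + 1 := by ring
  have e₄ : n + 4 = n + 1 + 1 + 1 + 1 := by ring
  have s₁ := startDebt_le_innerDebt (pending f (n - 5) n) (pending g (n - 8) n)
    (pending g (n - 1) n) (pending h (n - 4) n) (f n) (g n) (h n) (pending_mono g (by omega))
    (by rw [← pending_succ g (by omega), hg])
  rw [← pending_self f n, ← pending_succ f (by omega), ← pending_succ f (by omega),
    ← pending_succ g (by omega), ← pending_succ h (by omega)] at s₁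
  have s₂ := innerDebt_le_innerDebt (pending f (n - 5) (n + 1)) (pending f n (n + 1))
    (pending g (n - 1) (n + 1)) (pending h (n - 4) (n + 1)) (f (n + 1)) (g (n + 1)) (h (n + 1))
    (pending_mono f (by omega))
  rw [← pending_succ f (by omega), ← pending_succ f (by omega),
    ← pending_succ g (by omega), ← pending_succ h (by omega), ← e₂] at s₂
  have s₃ := innerDebt_le_innerDebt (pending f (n - 5) (n + 2)) (pending f n (n + 2))
    (pending g (n - 1) (n + 2)) (pending h (n - 4) (n + 2)) (f (n + 2)) (g (n + 2)) (h (n + 2))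
    (pending_mono f (by omega))
  rw [hf, Bool.false_and, ← pending_succ f (by omega),
    ← pending_succ g (by omega), ← pending_succ h (by omega)] at s₃
  have s₄ := innerDebt_le_startDebt (pending f n (n + 3))
    (pending g (n - 1) (n + 3)) (pending h (n - 4) (n + 3)) (f (n + 3)) (g (n + 3)) (h (n + 3))
  rw [← pending_self h (n + 3), ← pending_succ f (by omega), ← pending_succ g (by omega),
    ← pending_succ h (by omega), ← pending_succ h (by omega)] at s₄
  have t : debt g h f (n + 4) = startDebt (pending g (n - 1) (n + 3 + 1))
      (pending h (n - 4) (n + 3 + 1)) (pending h (n + 3) (n + 3 + 1))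
      (pending f n (n + 3 + 1)) := by
    unfold debt
    congr 2 <;> ring
  rw [show n + 2 + 1 = n + 3 by ring] at s₃
  rw [hf] at s₂
  rw [t]
  unfold debt
  omega

/-- The discretized lower bound over `k` consecutive periods. -/
theorem debt_le_periods (x : Fin 3 → ℤ → Bool) (k : ℕ)
    (hclosed : ∀ ρ : Fin 3, ∀ i : ℕ, i ≤ k →
      ∃ m, x ρ m = true ∧ 12 * (i : ℤ) + 4 * (ρ : ℕ) ≤ m ∧ m ≤ 12 * (i : ℤ) + 4 * (ρ : ℕ) + 8)
    (hopen : ∀ ρ : Fin 3, ∀ i : ℕ, i ≤ k →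
      ∃ m, x ρ m = true ∧ 12 * (i : ℤ) + 4 * (ρ : ℕ) - 5 ≤ m ∧
        m ≤ 12 * (i : ℤ) + 4 * (ρ : ℕ) + 1) :
    ∀ j ≤ k, 9 * j + debt (x 0) (x 1) (x 2) 12 ≤
      ∑ m ∈ Finset.range (12 * j), orderCost (x 0 (12 + m)) (x 1 (12 + m)) (x 2 (12 + m))
        + debt (x 0) (x 1) (x 2) (12 + 12 * j) := by
  intro j
  induction j with
  | zero => simp
  | succ j ih =>
    intro hj
    have ih := ih (by omega)
    obtain ⟨m₁, h₁, h₁l, h₁u⟩ := hclosed 1 j (by omega)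
    obtain ⟨m₂, h₂, h₂l, h₂u⟩ := hclosed 2 j (by omega)
    obtain ⟨m₀, h₀, h₀l, h₀u⟩ := hclosed 0 (j + 1) (by omega)
    obtain ⟨n₀, g₀, g₀l, g₀u⟩ := hopen 0 (j + 1) (by omega)
    obtain ⟨n₁, g₁, g₁l, g₁u⟩ := hopen 1 (j + 1) (by omega)
    obtain ⟨n₂, g₂, g₂l, g₂u⟩ := hopen 2 (j + 1) (by omega)
    simp only [Fin.val_zero, Fin.val_one, Fin.val_two, Nat.cast_add, Nat.cast_one, Nat.cast_zero,
      Nat.cast_ofNat] at h₁l h₁u h₂l h₂u h₀l h₀u g₀l g₀u g₁l g₁u g₂l g₂u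
    set n : ℤ := 12 + 12 * j with hn
    have b₁ := debt_le_unit (x 0) (x 1) (x 2) n
      (pending_eq_false h₁ (by omega) (by omega) rfl)
      (pending_eq_false (b := n + 1) g₀ (by omega) (by omega) (by omega))
    have b₂ := debt_le_unit (x 1) (x 2) (x 0) (n + 4)
      (pending_eq_false h₂ (by omega) (by omega) rfl)
      (pending_eq_false (b := n + 5) g₁ (by omega) (by omega) (by omega))
    have b₃ := debt_le_unit (x 2) (x 0) (x 1) (n + 8)
      (pending_eq_false h₀ (by omega) (by omega) rfl)
      (pending_eq_false (b := n + 9) g₂ (by omega) (by omega) (by omega))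
    simp only [orderCost_rotate (x 0 _) (x 1 _) (x 2 _), add_assoc, Int.reduceAdd] at b₂
    simp only [← orderCost_rotate (x 2 _) (x 0 _) (x 1 _), add_assoc, Int.reduceAdd] at b₃
    have hs : ∀ F : ℤ → ℕ, ∑ m ∈ Finset.range (12 * (j + 1)), F (12 + m) =
        ∑ m ∈ Finset.range (12 * j), F (12 + m) + (F n + F (n + 1) + F (n + 2) + F (n + 3) +
          F (n + 4) + F (n + 5) + F (n + 6) + F (n + 7) + F (n + 8) + F (n + 9) + F (n + 10) +
          F (n + 11)) := by
      intro F
      rw [mul_add, Finset.sum_range_add]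
      congr 1
      simp [Finset.sum_range_succ, hn, add_assoc]
    rw [hs fun m => orderCost (x 0 m) (x 1 m) (x 2 m)]
    have e : (12 : ℤ) + 12 * ((j + 1 : ℕ) : ℤ) = n + 12 := by
      push_cast
      omega
    rw [e]
    simp only [add_assoc] at b₁ ⊢
    omega

/-- Whether some order of the schedule in the given cell involves retailer `ρ`. -/
noncomputable def ordersIn (S : Finset (ℝ × Finset (Fin 3))) (ρ : Fin 3) (n : ℤ) : Bool :=
  open Classical in decide (ρ ∈ {o ∈ S | timeCell o.1 = n}.biUnion Prod.snd)

theorem ordersIn_timeCell {S : Finset (ℝ × Finset (Fin 3))} {o : ℝ × Finset (Fin 3)} {ρ : Fin 3}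
    (ho : o ∈ S) (hρ : ρ ∈ o.2) : ordersIn S ρ (timeCell o.1) = true := by
  simp only [ordersIn, decide_eq_true_eq, Finset.mem_biUnion, Finset.mem_filter]
  exact ⟨o, ⟨ho, rfl⟩, hρ⟩

theorem orderCost_ordersIn_le (S : Finset (ℝ × Finset (Fin 3))) (n : ℤ) :
    orderCost (ordersIn S 0 n) (ordersIn S 1 n) (ordersIn S 2 n) ≤
      ∑ o ∈ S with timeCell o.1 = n, (3 + o.2.card) := by
  classical
  have h := orderCost_mem ({o ∈ S | timeCell o.1 = n}.biUnion Prod.snd)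
  have hx : ∀ ρ : Fin 3, ordersIn S ρ n =
      decide (ρ ∈ {o ∈ S | timeCell o.1 = n}.biUnion Prod.snd) := by
    intro ρ
    simp only [ordersIn]
  rw [hx, hx, hx, h]
  split_ifs with hU
  · exact Nat.zero_le _
  · obtain ⟨ρ, hρ⟩ := Finset.nonempty_iff_ne_empty.2 hU
    obtain ⟨o, ho, -⟩ := Finset.mem_biUnion.1 hρ
    rw [Finset.sum_add_distrib]
    refine add_le_add ?_ Finset.card_biUnion_le
    rw [Finset.sum_const, smul_eq_mul]
    have := Finset.card_pos.2 ⟨o, ho⟩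
    omega

theorem sum_orderCost_ordersIn_le (S : Finset (ℝ × Finset (Fin 3))) (N : ℕ) :
    ∑ m ∈ Finset.range N, orderCost (ordersIn S 0 (12 + m)) (ordersIn S 1 (12 + m))
      (ordersIn S 2 (12 + m)) ≤ ∑ o ∈ S, (3 + o.2.card) := by
  classical
  calc _ ≤ ∑ m ∈ Finset.range N, ∑ o ∈ S with timeCell o.1 = 12 + m, (3 + o.2.card) :=
        Finset.sum_le_sum fun m _ => orderCost_ordersIn_le S _
    _ = ∑ o ∈ (Finset.range N).biUnion fun m => {o ∈ S | timeCell o.1 = 12 + m},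
          (3 + o.2.card) := by
        rw [Finset.sum_biUnion]
        intro a _ b _ hab
        refine Finset.disjoint_left.2 fun o ha hb => hab ?_
        simp only [Finset.mem_filter] at ha hb
        omega
    _ ≤ _ := by
        refine Finset.sum_le_sum_of_subset fun o ho => ?_
        obtain ⟨m, -, h⟩ := Finset.mem_biUnion.1 ho
        exact (Finset.mem_filter.1 h).1

theorem three_retailer_cycle_lower_bound :
    ∃ c : ℝ, 0 ≤ c ∧
      ∀ K : ℕ, 0 < K → 3 ∣ K →
        ∀ S : Finset (ℝ × Finset (Fin 3)),
          (∀ ρ : Fin 3, ∀ i : ℕ, i ≤ K / 3 →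
            (∃ o ∈ S, ρ ∈ o.2 ∧
              (3 * i + (ρ : ℕ) : ℝ) ≤ o.1 ∧ o.1 ≤ (3 * i + (ρ : ℕ) : ℝ) + 2) ∧
            (∃ o ∈ S, ρ ∈ o.2 ∧
              (3 * i : ℝ) - 3 / 2 + (ρ : ℕ) < o.1 ∧
                o.1 < (3 * i : ℝ) + 1 / 2 + (ρ : ℕ))) →
          (K : ℝ) - c ≤ ∑ o ∈ S, (1 + (o.2.card : ℝ) / 3) := by
  refine ⟨5, by norm_num, ?_⟩
  rintro K hK ⟨k, rfl⟩ S hS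
  rw [Nat.mul_div_cancel_left k (by norm_num)] at hS
  obtain ⟨j, rfl⟩ : ∃ j, k = j + 1 := ⟨k - 1, by omega⟩
  have key := debt_le_periods (ordersIn S) (j + 1) (fun ρ i hi => by
      obtain ⟨⟨o, ho, hρ, hl, hu⟩, -⟩ := hS ρ i hi
      refine ⟨_, ordersIn_timeCell ho hρ, ?_, ?_⟩
      · have := le_timeCell (t := o.1) (a := 6 * i + 2 * (ρ : ℕ)) (by push_cast; linarith)
        linarith
      · have := timeCell_le (t := o.1) (a := 6 * i + 2 * (ρ : ℕ) + 4) (by push_cast; linarith)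
        linarith) (fun ρ i hi => by
      obtain ⟨-, o, ho, hρ, hl, hu⟩ := hS ρ i hi
      refine ⟨_, ordersIn_timeCell ho hρ, ?_, ?_⟩
      · have := lt_timeCell (t := o.1) (a := 6 * i + 2 * (ρ : ℕ) - 3) (by push_cast; linarith)
        omega
      · have := timeCell_lt (t := o.1) (a := 6 * i + 2 * (ρ : ℕ) + 1) (by push_cast; linarith)
        omega) j (by omega)
  have hle := sum_orderCost_ordersIn_le S (12 * j)
  have hdebt : debt (ordersIn S 0) (ordersIn S 1) (ordersIn S 2) (12 + 12 * j) ≤ 6 :=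
    startDebt_le _ _ _ _
  have hnat : 9 * j ≤ ∑ o ∈ S, (3 + o.2.card) + 6 := by omega
  have hreal : (9 * j : ℝ) ≤ ∑ o ∈ S, (3 + (o.2.card : ℝ)) + 6 := by exact_mod_cast hnat
  have hsum : ∑ o ∈ S, (3 + (o.2.card : ℝ)) = 3 * ∑ o ∈ S, (1 + (o.2.card : ℝ) / 3) := by
    rw [Finset.mul_sum]
    exact Finset.sum_congr rfl fun o _ => by ring
  push_cast
  linarith
end

section
/- For every ε > 0 there exist a continuous-time JRP-D instance (C, c, D) in which all demand periods are closed intervals of the same length, and a feasible fractional solution x of its continuous-time LP relaxation, such that every feasible schedule for the instance has cost at least (6/5 − ε) · cost(x). In particular, the integrality gap of the LP relaxation of JRP-D restricted to instances with equal-length demand periods is at least 1.2. -/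
/-- The `1`-periodic pulse of height `δ⁻¹` on the intervals `[n, n + δ]`. -/
noncomputable def pulse (δ t : ℝ) : ℝ := if Int.fract t ≤ δ then δ⁻¹ else 0

lemma pulse_measurable (δ : ℝ) : Measurable (pulse δ) :=
  Measurable.ite (measurableSet_le measurable_fract measurable_const)
    measurable_const measurable_const

lemma pulse_nonneg {δ : ℝ} (hδ : 0 ≤ δ) (t : ℝ) : 0 ≤ pulse δ t := by
  unfold pulse
  split_ifs <;> positivity

lemma pulse_periodic (δ : ℝ) : Function.Periodic (pulse δ) 1 := fun t => by
  simp [pulse]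

lemma pulse_intervalIntegrable (δ a b : ℝ) :
    IntervalIntegrable (pulse δ) MeasureTheory.volume a b := by
  refine (intervalIntegrable_const (c := δ⁻¹)).mono_fun
    (pulse_measurable δ).aestronglyMeasurable (Filter.Eventually.of_forall fun t => ?_)
  simp only [pulse]
  split_ifs <;> simp

lemma integral_pulse_start {δ : ℝ} (hδ : 0 < δ) (hδ1 : δ < 1) :
    ∫ t in (0 : ℝ)..δ, pulse δ t = 1 := by
  have h : ∫ t in (0 : ℝ)..δ, pulse δ t = ∫ _t in (0 : ℝ)..δ, δ⁻¹ := by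
    refine intervalIntegral.integral_congr fun t ht => ?_
    rw [Set.uIcc_of_le hδ.le] at ht
    have : Int.fract t = t := Int.fract_eq_self.2 ⟨ht.1, ht.2.trans_lt hδ1⟩
    simp [pulse, this, ht.2]
  rw [h, intervalIntegral.integral_const, sub_zero, smul_eq_mul, mul_inv_cancel₀ hδ.ne']

lemma integral_pulse_unit {δ : ℝ} (hδ : 0 < δ) (hδ1 : δ < 1) :
    ∫ t in (0 : ℝ)..1, pulse δ t = 1 := by
  have h : ∫ t in δ..1, pulse δ t = 0 := by
    refine intervalIntegral.integral_zero_ae ?_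
    filter_upwards [MeasureTheory.Measure.ae_ne MeasureTheory.volume (1 : ℝ)] with t ht1 ht
    rw [Set.uIoc_of_le hδ1.le] at ht
    have : Int.fract t = t :=
      Int.fract_eq_self.2 ⟨(hδ.trans ht.1).le, lt_of_le_of_ne ht.2 ht1⟩
    simp [pulse, this, ht.1]
  rw [← intervalIntegral.integral_add_adjacent_intervals
    (pulse_intervalIntegrable δ 0 δ) (pulse_intervalIntegrable δ δ 1),
    integral_pulse_start hδ hδ1, h, add_zero]

lemma integral_pulse_nat {δ : ℝ} (hδ : 0 < δ) (hδ1 : δ < 1) (s : ℝ) (n : ℕ) :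
    ∫ t in s..s + n, pulse δ t = n := by
  have h := (pulse_periodic δ).intervalIntegral_add_zsmul_eq n s
    (fun a b => pulse_intervalIntegrable δ a b)
  have h1 := (pulse_periodic δ).intervalIntegral_add_eq s 0
  rw [zero_add] at h1
  simpa [h1, integral_pulse_unit hδ hδ1] using h

lemma integral_pulse_nat_add {δ : ℝ} (hδ : 0 < δ) (hδ1 : δ < 1) (z : ℤ) (n : ℕ) :
    ∫ t in (z : ℝ)..z + n + δ, pulse δ t = n + 1 := by
  have h : ∫ t in (z + n : ℝ)..z + n + δ, pulse δ t = 1 := by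
    rw [← integral_pulse_start hδ hδ1]
    have := intervalIntegral.integral_comp_add_right (a := 0) (b := δ) (pulse δ) (z + n : ℝ)
    rw [zero_add, add_comm δ] at this
    rw [← this]
    congr 1
    ext t
    simpa [pulse, add_assoc] using by
      have : Int.fract (t + ((z : ℝ) + n)) = Int.fract t := by
        exact_mod_cast Int.fract_add_intCast t (z + n)
      rw [this]
  rw [← intervalIntegral.integral_add_adjacent_intervals
    (pulse_intervalIntegrable δ _ (z + n)) (pulse_intervalIntegrable δ _ _),
    integral_pulse_nat hδ hδ1, h]

lemma le_integral_pulse {δ : ℝ} (hδ : 0 < δ) (hδ1 : δ < 1) (s : ℝ) (n : ℕ) :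
    (n : ℝ) ≤ ∫ t in s..s + n + δ, pulse δ t := by
  rw [← intervalIntegral.integral_add_adjacent_intervals
    (pulse_intervalIntegrable δ _ (s + n)) (pulse_intervalIntegrable δ _ _),
    integral_pulse_nat hδ hδ1]
  have := intervalIntegral.integral_nonneg (μ := MeasureTheory.volume)
    (le_add_of_nonneg_right hδ.le : s + n ≤ s + n + δ) fun t _ => pulse_nonneg hδ.le t
  linarith

/-- If `S` contains an order in every window of length `2 + δ`, and an order of retailer `1` in
every such window starting at an integer, then the orders of `S` up to an order `o` of retailer `1`
cost at least about the time of `o`, where an order costs `1`, plus `1` if it serves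
retailer `1`. -/
lemma time_le_cost {S : Finset (ℝ × Finset (Fin 2))} {δ U : ℝ} (hδ : 0 < δ) (hδ1 : δ < 1)
    (hall : ∀ s, 0 ≤ s → s + 2 + δ ≤ U → ∃ o ∈ S, s ≤ o.1 ∧ o.1 ≤ s + 2 + δ)
    (hint : ∀ n : ℤ, (0 : ℝ) ≤ n → n + 2 + δ ≤ U →
      ∃ o ∈ S, 1 ∈ o.2 ∧ (n : ℝ) ≤ o.1 ∧ o.1 ≤ n + 2 + δ)
    (o : ℝ × Finset (Fin 2)) (ho : o ∈ S) (ho1 : 1 ∈ o.2) (hoU : o.1 ≤ U) :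
    o.1 ≤ 4 + (1 + δ) * ∑ p ∈ S with p.1 ≤ o.1, (1 + if 1 ∈ p.2 then (1 : ℝ) else 0) := by
  set w : ℝ × Finset (Fin 2) → ℝ := fun p => 1 + if 1 ∈ p.2 then (1 : ℝ) else 0 with hw
  have hw1 : ∀ p, 1 ≤ w p := fun p => by simp only [hw]; split_ifs <;> norm_num
  set f : ℝ → ℝ := fun u => ∑ p ∈ S with p.1 ≤ u, w p with hf
  have hf0 : ∀ u, 0 ≤ f u := fun u => Finset.sum_nonneg fun p _ => zero_le_one.trans (hw1 p)
  change o.1 ≤ 4 + (1 + δ) * f o.1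
  by_contra hbad
  obtain ⟨b, hb, hmin⟩ := Finset.exists_min_image
    (S.filter fun p => 1 ∈ p.2 ∧ p.1 ≤ U ∧ ¬ p.1 ≤ 4 + (1 + δ) * f p.1) Prod.fst
    ⟨o, Finset.mem_filter.2 ⟨ho, ho1, hoU, hbad⟩⟩
  obtain ⟨hbS, hb1, hbU, hb⟩ := Finset.mem_filter.1 hb
  have hwb : w b = 2 := by simp only [hw, hb1, if_true]; norm_num
  have hb4 : 4 < b.1 := by nlinarith [hf0 b.1]
  obtain ⟨a, haS, ha1, ha0, hab⟩ := hint 0 (by simp) (by push_cast; linarith)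
  push_cast at ha0 hab
  obtain ⟨v, hv, hmax⟩ := Finset.exists_max_image
    (S.filter fun p => 1 ∈ p.2 ∧ p.1 < b.1) Prod.fst
    ⟨a, Finset.mem_filter.2 ⟨haS, ha1, by linarith⟩⟩
  obtain ⟨hvS, hv1, hvb⟩ := Finset.mem_filter.1 hv
  have hv0 : 0 ≤ v.1 := ha0.trans (hmax a (Finset.mem_filter.2 ⟨haS, ha1, by linarith⟩))
  have hvgood : v.1 ≤ 4 + (1 + δ) * f v.1 := by
    by_contra h
    exact absurd (hmin v (Finset.mem_filter.2 ⟨hvS, hv1, by linarith, h⟩)) (not_le.2 hvb)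
  have hgap : b.1 ≤ v.1 + 3 + δ := by
    by_contra! h
    have h1 := Int.floor_le v.1
    have h2 := Int.lt_floor_add_one v.1
    obtain ⟨q, hqS, hq1, hvq, hqb⟩ := hint (⌊v.1⌋ + 1) (by push_cast; linarith)
      (by push_cast; linarith)
    push_cast at hvq hqb
    linarith [hmax q (Finset.mem_filter.2 ⟨hqS, hq1, by linarith⟩)]
  have hstep : ∀ T : Finset (ℝ × Finset (Fin 2)), T ⊆ S →
      (∀ p ∈ T, v.1 < p.1 ∧ p.1 ≤ b.1) → f v.1 + ∑ p ∈ T, w p ≤ f b.1 := by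
    intro T hTS hT
    rw [hf, ← Finset.sum_union]
    · refine Finset.sum_le_sum_of_subset_of_nonneg ?_
        fun p _ _ => zero_le_one.trans (hw1 p)
      intro p hp
      rcases Finset.mem_union.1 hp with hp | hp
      · exact Finset.mem_filter.2 ⟨(Finset.mem_filter.1 hp).1,
          (Finset.mem_filter.1 hp).2.trans hvb.le⟩
      · exact Finset.mem_filter.2 ⟨hTS hp, (hT p hp).2⟩
    · refine Finset.disjoint_left.2 fun p hp hpT => ?_
      exact absurd (Finset.mem_filter.1 hp).2 (not_le.2 (hT p hpT).1)
  by_cases hsmall : b.1 ≤ v.1 + 2 + δ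
  · have h := hstep {b} (by simpa using hbS) (by simpa using hvb)
    rw [Finset.sum_singleton, hwb] at h
    nlinarith
  · push Not at hsmall
    obtain ⟨q, hqS, hvq, hqb⟩ := hall ((v.1 + b.1 - 2 - δ) / 2) (by linarith) (by linarith)
    have hqb' : q.1 < b.1 := by linarith
    have h := hstep {q, b} (by simp [Finset.insert_subset_iff, hqS, hbS]) (by
      intro p hp
      rcases Finset.mem_insert.1 hp with rfl | hp
      · exact ⟨by linarith, hqb'.le⟩
      · rw [Finset.mem_singleton.1 hp]; exact ⟨hvb, le_rfl⟩)
    rw [Finset.sum_pair (fun e => hqb'.ne (congrArg Prod.fst e)), hwb] at h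
    nlinarith [hw1 q]

/-!
STATEMENT 14: For every ε > 0 there exist a continuous-time JRP-D instance in
which all demand periods are closed intervals of the same length, and a
feasible fractional solution x of its continuous-time LP relaxation, such that
every feasible schedule has cost at least (6/5 − ε)·cost(x).  In particular,
the integrality gap of the LP relaxation restricted to instances with
equal-length demand periods is at least 1.2.
-/

theorem jrpd_equal_periods_integrality_gap_lower_bound :
    (∀ ε : ℝ, 0 < ε →
      ∃ (m : ℕ) (C : ℝ) (c : Fin m → ℝ) (U : ℝ) (D : Set (Fin m × ℝ × ℝ))
        (x : ℝ → ℝ) (xr : Fin m → ℝ → ℝ) (L : ℝ),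
        0 ≤ C ∧ (∀ ρ, 0 ≤ c ρ) ∧ 0 ≤ U ∧
        (∀ d ∈ D, 0 ≤ d.2.1 ∧ d.2.1 ≤ d.2.2 ∧ d.2.2 ≤ U) ∧
        (∀ d ∈ D, d.2.2 - d.2.1 = L) ∧
        Measurable x ∧ (∀ ρ, Measurable (xr ρ)) ∧
        (∀ t, 0 ≤ x t) ∧ (∀ ρ t, 0 ≤ xr ρ t ∧ xr ρ t ≤ x t) ∧
        (∀ d ∈ D, 1 ≤ ∫ t in d.2.1..d.2.2, xr d.1 t) ∧
        0 < (∫ t in (0:ℝ)..U, (C * x t + ∑ ρ, c ρ * xr ρ t)) ∧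
        ∀ S : Finset (ℝ × Finset (Fin m)),
          (∀ d ∈ D, ∃ o ∈ S, d.1 ∈ o.2 ∧ d.2.1 ≤ o.1 ∧ o.1 ≤ d.2.2) →
          (6 / 5 - ε) * (∫ t in (0:ℝ)..U, (C * x t + ∑ ρ, c ρ * xr ρ t)) ≤
            ∑ o ∈ S, (C + ∑ ρ ∈ o.2, c ρ)) ∧
    (1.2 : ℝ) ≤ 6 / 5 := by
  refine ⟨fun ε hε => ?_, by norm_num⟩
  obtain ⟨δ, hδ, hδ1, hδε⟩ : ∃ δ : ℝ, 0 < δ ∧ δ < 1 ∧ 2 * δ ≤ ε :=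
    ⟨min ε 1 / 2, by positivity, by linarith [min_le_right ε 1], by linarith [min_le_left ε 1]⟩
  obtain ⟨N, hN⟩ := exists_nat_gt (21 / δ)
  have hNδ : 21 < N * δ := (div_lt_iff₀ hδ).1 hN
  have hN2 : (21 : ℝ) < N := by nlinarith
  have hcost : ∫ t in (0 : ℝ)..N + δ,
      (1 * (1 / 2 * pulse δ t) + ∑ ρ : Fin 2, (![0, 1] : Fin 2 → ℝ) ρ *
        ((![1 / 2, 1 / 3] : Fin 2 → ℝ) ρ * pulse δ t)) = 5 / 6 * (N + 1) := by
    have h := integral_pulse_nat_add hδ hδ1 0 N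
    rw [Int.cast_zero, zero_add] at h
    rw [← h, ← intervalIntegral.integral_const_mul]
    congr 1
    ext t
    simp [Fin.sum_univ_two]
    ring
  refine ⟨2, 1, ![0, 1], N + δ,
    {d | 0 ≤ d.2.1 ∧ d.2.2 = d.2.1 + 2 + δ ∧ d.2.2 ≤ N + δ ∧ (d.1 = 1 → ∃ n : ℤ, d.2.1 = n)},
    fun t => 1 / 2 * pulse δ t,
    fun ρ t => (![1 / 2, 1 / 3] : Fin 2 → ℝ) ρ * pulse δ t, 2 + δ, zero_le_one, ?_,
    by positivity, ?_, ?_, (pulse_measurable δ).const_mul _,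
    fun ρ => (pulse_measurable δ).const_mul _, ?_, ?_, ?_, ?_, ?_⟩
  · intro ρ; fin_cases ρ <;> simp
  · rintro d ⟨h0, h1, h2, -⟩
    exact ⟨h0, by linarith, h2⟩
  · rintro d ⟨-, h1, -⟩
    linarith
  · intro t
    have := pulse_nonneg hδ.le t
    positivity
  · intro ρ t
    have := pulse_nonneg hδ.le t
    fin_cases ρ
    · exact ⟨by simpa using this, by simp⟩
    · exact ⟨by simpa using this, by simp; linarith⟩
  · rintro ⟨ρ, r, d⟩ ⟨-, hd, -, h⟩
    obtain rfl : d = r + 2 + δ := hd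
    rw [intervalIntegral.integral_const_mul]
    fin_cases ρ
    · have := le_integral_pulse hδ hδ1 r 2
      simp at this ⊢
      linarith
    · obtain ⟨n, hn⟩ := h rfl
      have := integral_pulse_nat_add hδ hδ1 n 2
      simp at this hn ⊢
      rw [hn, this]
      norm_num
  · rw [hcost]; positivity
  · intro S hS
    have hall : ∀ s, 0 ≤ s → s + 2 + δ ≤ N + δ → ∃ o ∈ S, s ≤ o.1 ∧ o.1 ≤ s + 2 + δ := by
      intro s hs hsU
      obtain ⟨o, ho, -, h⟩ := hS (0, s, s + 2 + δ) ⟨hs, rfl, hsU, by simp⟩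
      exact ⟨o, ho, h⟩
    have hint : ∀ n : ℤ, (0 : ℝ) ≤ n → n + 2 + δ ≤ N + δ →
        ∃ o ∈ S, 1 ∈ o.2 ∧ (n : ℝ) ≤ o.1 ∧ o.1 ≤ n + 2 + δ := by
      intro n hn hnU
      exact hS (1, n, n + 2 + δ) ⟨hn, rfl, hnU, fun _ => ⟨n, rfl⟩⟩
    obtain ⟨o, ho, ho1, hNo, hoU⟩ := hint (N - 2) (by push_cast; linarith) (by push_cast; linarith)
    push_cast at hNo hoU
    have hle := time_le_cost hδ hδ1 hall hint o ho ho1 (by linarith)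
    have hw : ∀ R : Finset (Fin 2),
        ∑ ρ ∈ R, (![0, 1] : Fin 2 → ℝ) ρ = if 1 ∈ R then 1 else 0 := by
      intro R
      rw [← Finset.sum_ite_eq' R 1 fun _ => (1 : ℝ)]
      refine Finset.sum_congr rfl fun ρ _ => ?_
      fin_cases ρ <;> simp
    have hsub : ∑ p ∈ S with p.1 ≤ o.1, (1 + if 1 ∈ p.2 then (1 : ℝ) else 0) ≤
        ∑ p ∈ S, (1 + if 1 ∈ p.2 then (1 : ℝ) else 0) :=
      Finset.sum_le_sum_of_subset_of_nonneg (Finset.filter_subset _ _)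
        fun p _ _ => by split_ifs <;> norm_num
    rw [hcost]
    simp only [hw]
    set K := ∑ p ∈ S, (1 + if 1 ∈ p.2 then (1 : ℝ) else 0)
    have hK : (N : ℝ) - 6 ≤ (1 + δ) * K := by nlinarith
    have h1 : (6 / 5 - ε) * (5 / 6 * ((N : ℝ) + 1)) ≤ (1 - 5 / 3 * δ) * (N + 1) := by nlinarith
    have h2 : (1 + δ) * ((1 - 5 / 3 * δ) * ((N : ℝ) + 1)) ≤ N - 6 := by
      nlinarith [mul_nonneg (mul_nonneg hδ.le hδ.le) (by positivity : (0 : ℝ) ≤ N + 1)]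
    exact h1.trans (le_of_mul_le_mul_left (h2.trans hK) (by linarith))
end

section
/- Let L > 0 and let α, β be reals with α + L < β. Consider the four intervals Q_0 = [α−L, α], Q_1 = [α, α+L], Q_2 = [β−L, β], Q_3 = [β, β+L]. Call a finite set T ⊆ ℝ feasible if each of Q_0, Q_1, Q_2, Q_3 contains at least one point of T. Then every feasible set T has |T| ≥ 2, the set {α, β} is feasible, and {α, β} is the only feasible set of size exactly 2. -/
/-!
STATEMENT 17: For L > 0 and α + L < β, with Q_0 = [α−L, α], Q_1 = [α, α+L],
Q_2 = [β−L, β], Q_3 = [β, β+L], call a finite set T ⊆ ℝ feasible if it meets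
each Q_k.  Then every feasible T has |T| ≥ 2, {α, β} is feasible, and {α, β}
is the only feasible set of size exactly 2.
-/

/-- `T` meets each of the four intervals. -/
def GadgetFeasible (L α β : ℝ) (T : Finset ℝ) : Prop :=
  (∃ t ∈ T, α - L ≤ t ∧ t ≤ α) ∧ (∃ t ∈ T, α ≤ t ∧ t ≤ α + L) ∧
  (∃ t ∈ T, β - L ≤ t ∧ t ≤ β) ∧ (∃ t ∈ T, β ≤ t ∧ t ≤ β + L)

theorem vertex_gadget_key_property
    (L α β : ℝ) (hL : 0 < L) (hαβ : α + L < β) :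
    (∀ T : Finset ℝ, GadgetFeasible L α β T → 2 ≤ T.card) ∧
    GadgetFeasible L α β ({α, β} : Finset ℝ) ∧
    (∀ T : Finset ℝ, GadgetFeasible L α β T → T.card = 2 →
      T = ({α, β} : Finset ℝ)) := by
  refine ⟨?_, ?_, ?_⟩
  · rintro T ⟨⟨a, ha, -, ha'⟩, -, -, ⟨b, hb, hb', -⟩⟩
    exact Finset.one_lt_card.mpr ⟨a, ha, b, hb, (by linarith : a < b).ne⟩
  · refine ⟨⟨α, ?_⟩, ⟨α, ?_⟩, ⟨β, ?_⟩, ⟨β, ?_⟩⟩ <;> simp [hL.le]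
  · rintro T ⟨⟨a, ha, -, ha'⟩, ⟨c, hc, hc₁, hc₂⟩, ⟨d, hd, hd₁, hd₂⟩, ⟨b, hb, hb', -⟩⟩ hT
    have hab : a ≠ b := (by linarith : a < b).ne
    have hT' : T = {a, b} := by
      refine (Finset.eq_of_subset_of_card_le ?_ ?_).symm
      · simp [Finset.insert_subset_iff, ha, hb]
      · rw [hT, Finset.card_pair hab]
    subst hT'
    simp only [Finset.mem_insert, Finset.mem_singleton] at hc hd
    have hca : a = α := by rcases hc with rfl | rfl <;> linarith
    have hdb : b = β := by rcases hd with rfl | rfl <;> linarith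
    rw [hca, hdb]
end
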